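/- arXiv:2509.21756 — 10 statements merged into one kernel-verified Lean document; each statement's English description precedes it below -/
import Mathlib

section
/- Let $t \ge 2$ and $n \ge 1$ be integers. If $G$ is a 3-partite graph with three vertex classes $V_1, V_2, V_3$, each of size $n$, and $G$ contains no copy of the complete bipartite graph $K_{2,t}$, then the number of edges of $G$ satisfies $e(G) \le \frac{3}{2} n \left(1 + \sqrt{2(t-1)(n-1)+1}\right)$. -/
open Finset

namespace SimpleGraph

/-- The number of edges from `v` into the part with index `i`. -/
noncomputable def partDegree {ι α : Type*} [Fintype α] (G : SimpleGraph (ι × α))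
    [DecidableRel G.Adj] (v : ι × α) (i : ι) : ℝ :=
  ∑ x, G.adjMatrix ℝ v (i, x)

lemma sum_adjMatrix_mul_adjMatrix {V : Type*} [Fintype V] (G : SimpleGraph V)
    [DecidableRel G.Adj] (u w : V) :
    ∑ v, G.adjMatrix ℝ v u * G.adjMatrix ℝ v w = (G.commonNeighbors u w).ncard := by
  classical
  have hset : G.commonNeighbors u w = ({v | G.Adj v u ∧ G.Adj v w} : Finset V) := by
    ext v
    simp [mem_commonNeighbors, G.adj_comm]
  rw [hset, Set.ncard_coe_finset]
  simp [adjMatrix_apply, ← ite_and, and_comm]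

lemma sum_degree_eq_two_mul_ncard_edgeSet {V : Type*} [Fintype V] (G : SimpleGraph V)
    [DecidableRel G.Adj] : ∑ v, (G.degree v : ℝ) = 2 * G.edgeSet.ncard := by
  classical
  rw [← coe_edgeFinset, Set.ncard_coe_finset]
  exact_mod_cast G.sum_degrees_eq_twice_card_edges

section Parts

variable {ι α : Type*} [Fintype ι] [Fintype α] (G : SimpleGraph (ι × α)) [DecidableRel G.Adj]

lemma sum_partDegree (v : ι × α) : ∑ i, G.partDegree v i = G.degree v := by
  simp only [partDegree, ← Fintype.sum_prod_type (fun u => G.adjMatrix ℝ v u)]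
  simp [adjMatrix_apply, ← card_neighborFinset_eq_degree, neighborFinset_eq_filter]

/-- Double counting of the paths of length two whose endpoints lie in the same part. -/
lemma sum_sq_partDegree :
    ∑ v, ∑ i, G.partDegree v i ^ 2 =
      ∑ i, ∑ x, ∑ y, ((G.commonNeighbors (i, x) (i, y)).ncard : ℝ) := by
  simp only [← sum_adjMatrix_mul_adjMatrix, partDegree, sq, sum_mul_sum]
  rw [sum_comm]
  refine sum_congr rfl fun i _ => ?_
  rw [sum_comm]
  exact sum_congr rfl fun x _ => sum_comm

lemma sum_sq_partDegree_le {s : ℝ}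
    (hs : ∀ u v, u ≠ v → ((G.commonNeighbors u v).ncard : ℝ) ≤ s) :
    ∑ v, ∑ i, G.partDegree v i ^ 2 ≤
      ∑ v, (G.degree v : ℝ) +
        Fintype.card ι * Fintype.card α * ((Fintype.card α : ℝ) - 1) * s := by
  classical
  have hrow (i : ι) (x : α) : ∑ y, ((G.commonNeighbors (i, x) (i, y)).ncard : ℝ) ≤
      G.degree (i, x) + ((Fintype.card α : ℝ) - 1) * s := by
    rw [← add_sum_erase _ _ (mem_univ x)]
    gcongr
    · rw [commonNeighbors, Set.inter_self, ← card_neighborFinset_eq_degree,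
        ← Set.ncard_coe_finset, coe_neighborFinset]
    · have hpos : 1 ≤ Fintype.card α := Fintype.card_pos_iff.mpr ⟨x⟩
      refine (sum_le_card_nsmul _ _ s fun y hy => hs _ _ ?_).trans_eq ?_
      · simpa using (ne_of_mem_erase hy).symm
      · simp [card_erase_of_mem, Nat.cast_sub hpos]
  rw [sum_sq_partDegree]
  refine (sum_le_sum fun i _ => sum_le_sum fun x _ => hrow i x).trans_eq ?_
  simp only [sum_add_distrib, sum_const, card_univ, nsmul_eq_mul, Fintype.sum_prod_type]
  ring

end Parts

lemma sq_degree_le_two_mul_sum_sq_partDegree {α : Type*} [Fintype α]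
    (G : SimpleGraph (Fin 3 × α)) [DecidableRel G.Adj]
    (htri : ∀ u v, G.Adj u v → u.1 ≠ v.1) (v : Fin 3 × α) :
    (G.degree v : ℝ) ^ 2 ≤ 2 * ∑ i, G.partDegree v i ^ 2 := by
  have hzero : G.partDegree v v.1 = 0 :=
    sum_eq_zero fun x _ => by
      have hnadj : ¬ G.Adj v (v.1, x) := fun h => htri _ _ h rfl
      simp [adjMatrix_apply, hnadj]
  rw [← sum_partDegree]
  obtain ⟨j, x⟩ := v
  simp only [Fin.sum_univ_three]
  fin_cases j <;> simp only [Fin.zero_eta, Fin.mk_one, Fin.reduceFinMk] at hzero ⊢ <;>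
    rw [hzero]
  · nlinarith [sq_nonneg (G.partDegree (0, x) 1 - G.partDegree (0, x) 2)]
  · nlinarith [sq_nonneg (G.partDegree (1, x) 0 - G.partDegree (1, x) 2)]
  · nlinarith [sq_nonneg (G.partDegree (2, x) 0 - G.partDegree (2, x) 1)]

end SimpleGraph

/-- If `G` is a 3-partite graph with three parts of size `n`
(vertex `u` belongs to part `u.1`) containing no copy of `K_{2,t}` (i.e. any two distinct
vertices have at most `t-1` common neighbours), then
`e(G) ≤ (3/2) n (1 + √(2(t-1)(n-1)+1))`. -/
theorem stmt_0 (t n : ℕ) (ht : 2 ≤ t) (hn : 1 ≤ n)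
    (G : SimpleGraph (Fin 3 × Fin n))
    (htri : ∀ u v, G.Adj u v → u.1 ≠ v.1)
    (hfree : ∀ u v : Fin 3 × Fin n, u ≠ v → (G.commonNeighbors u v).ncard ≤ t - 1) :
    (G.edgeSet.ncard : ℝ) ≤
      (3 / 2 : ℝ) * n * (1 + Real.sqrt (2 * ((t : ℝ) - 1) * ((n : ℝ) - 1) + 1)) := by
  classical
  have hs : ∀ u v, u ≠ v → ((G.commonNeighbors u v).ncard : ℝ) ≤ (t : ℝ) - 1 := by
    intro u v huv
    have h : ((G.commonNeighbors u v).ncard : ℝ) ≤ ((t - 1 : ℕ) : ℝ) := by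
      exact_mod_cast hfree u v huv
    rwa [Nat.cast_sub (by omega), Nat.cast_one] at h
  have hpaths := G.sum_sq_partDegree_le hs
  have hparts := sum_le_sum fun v (_ : v ∈ univ) =>
    G.sq_degree_le_two_mul_sum_sq_partDegree htri v
  have hcauchy := sq_sum_le_card_mul_sum_sq (s := univ) (f := fun v => (G.degree v : ℝ))
  rw [← mul_sum] at hparts
  rw [G.sum_degree_eq_two_mul_ncard_edgeSet] at hpaths hcauchy
  simp only [card_univ, Fintype.card_prod, Fintype.card_fin] at hpaths hcauchy
  push_cast at hpaths hcauchy
  set e : ℝ := (G.edgeSet.ncard : ℝ)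
  have hn' : (0 : ℝ) < n := by exact_mod_cast hn
  have hquad : (2 * e) ^ 2 ≤
      3 * n * (2 * (2 * e + 3 * n * ((n : ℝ) - 1) * ((t : ℝ) - 1))) :=
    hcauchy.trans (mul_le_mul_of_nonneg_left
      (hparts.trans (mul_le_mul_of_nonneg_left hpaths zero_le_two)) (by positivity))
  have hroot : 2 * e / (3 * n) - 1 ≤
      Real.sqrt (2 * ((t : ℝ) - 1) * ((n : ℝ) - 1) + 1) := by
    apply Real.le_sqrt_of_sq_le
    have he : 2 * e = 2 * e / (3 * n) * (3 * n) := by field_simp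
    generalize 2 * e / (3 * n) = d at he ⊢
    rw [he] at hquad
    have hn2 : (0 : ℝ) < 9 * n ^ 2 := by positivity
    refine le_of_mul_le_mul_left ?_ hn2
    linear_combination hquad
  rw [sub_le_iff_le_add, div_le_iff₀ (by positivity)] at hroot
  linear_combination hroot / 2
end

section
/- Let $t \ge 2$ and $n \ge 1$ be integers, and let $G$ be a $K_{2,t}$-free 3-partite graph with vertex classes $V_1, V_2, V_3$, each of size $n$. Then the total number of edges of $G$ incident with $V_3$ (i.e., the number of edges between $V_1$ and $V_3$ plus the number of edges between $V_2$ and $V_3$) is at most $n\left(1 + \sqrt{2(t-1)(n-1)+1}\right)$. -/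
open Finset in
/-- If any two distinct elements of `B` are both related to at most `s` elements of `A`, then the
number of ordered pairs of distinct elements of `B` related to a common `a ∈ A`, counted with
multiplicity, is at most `s` times the number of ordered pairs of distinct elements of `B`. -/
theorem sum_card_offDiag_bipartiteAbove_le {α β : Type*} [DecidableEq β]
    (r : α → β → Prop) [∀ a, DecidablePred (r a)] (A : Finset α) (B : Finset β) (s : ℕ)
    (h : ∀ b ∈ B, ∀ b' ∈ B, b ≠ b' → #{a ∈ A | r a b ∧ r a b'} ≤ s) :
    ∑ a ∈ A, #(B.bipartiteAbove r a).offDiag ≤ #B.offDiag * s := by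
  calc ∑ a ∈ A, #(B.bipartiteAbove r a).offDiag
      = ∑ a ∈ A, #(B.offDiag.bipartiteAbove (fun a p => r a p.1 ∧ r a p.2) a) := by
        refine sum_congr rfl fun a _ => congrArg card ?_
        ext p
        simp only [mem_offDiag, mem_bipartiteAbove]
        tauto
    _ = ∑ p ∈ B.offDiag, #(A.bipartiteBelow (fun a p => r a p.1 ∧ r a p.2) p) :=
        sum_card_bipartiteAbove_eq_sum_card_bipartiteBelow _
    _ ≤ #B.offDiag * s := by
        refine sum_le_card_nsmul _ _ _ fun p hp => ?_
        obtain ⟨h₁, h₂, hne⟩ := mem_offDiag.1 hp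
        exact h _ h₁ _ h₂ hne

open Finset in
/-- Kővári–Sós–Turán bound in quadratic form. -/
theorem sq_sum_card_bipartiteAbove_le {α β : Type*} [DecidableEq β]
    (r : α → β → Prop) [∀ a, DecidablePred (r a)] (A : Finset α) (B : Finset β) (s : ℕ)
    (h : ∀ b ∈ B, ∀ b' ∈ B, b ≠ b' → #{a ∈ A | r a b ∧ r a b'} ≤ s) :
    (∑ a ∈ A, (#(B.bipartiteAbove r a) : ℝ)) ^ 2 ≤
      #A * (∑ a ∈ A, (#(B.bipartiteAbove r a) : ℝ) + #B * (#B - 1) * s) := by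
  have card_offDiag_real : ∀ C : Finset β, (#C.offDiag : ℝ) = #C * (#C - 1) := fun C => by
    rw [offDiag_card, Nat.cast_sub (Nat.le_mul_self _)]
    push_cast
    ring
  have hpairs : ∑ a ∈ A, (#(B.bipartiteAbove r a) : ℝ) * (#(B.bipartiteAbove r a) - 1) ≤
      #B * (#B - 1) * s := by
    simp only [← card_offDiag_real]
    exact_mod_cast sum_card_offDiag_bipartiteAbove_le r A B s h
  refine sq_sum_le_card_mul_sum_sq.trans (mul_le_mul_of_nonneg_left ?_ (Nat.cast_nonneg _))
  refine le_trans (le_of_eq ?_) (add_le_add_right hpairs _)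
  rw [← sum_add_distrib]
  exact sum_congr rfl fun a _ => by ring

/-- For a `K_{2,t}`-free 3-partite graph `G` with parts of size `n`
(vertex `u` lies in part `u.1`), the number of edges between `V₁` and `V₃` plus the
number of edges between `V₂` and `V₃` is at most `n (1 + √(2(t-1)(n-1)+1))`.
Edges between two distinct parts are counted as ordered pairs `(u, v)` with `u` in the
first part and `v` in the second part, so each such edge is counted exactly once. -/
theorem stmt_2 (t n : ℕ) (ht : 2 ≤ t) (hn : 1 ≤ n)
    (G : SimpleGraph (Fin 3 × Fin n)) [DecidableRel G.Adj]
    (htri : ∀ u v, G.Adj u v → u.1 ≠ v.1)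
    (hfree : ∀ u v : Fin 3 × Fin n, u ≠ v → (G.commonNeighbors u v).ncard ≤ t - 1)
    (m13 m23 : ℕ)
    (hm13 : m13 = (Finset.univ.filter (fun e : (Fin 3 × Fin n) × (Fin 3 × Fin n) =>
          e.1.1 = 0 ∧ e.2.1 = 2 ∧ G.Adj e.1 e.2)).card)
    (hm23 : m23 = (Finset.univ.filter (fun e : (Fin 3 × Fin n) × (Fin 3 × Fin n) =>
          e.1.1 = 1 ∧ e.2.1 = 2 ∧ G.Adj e.1 e.2)).card) :
    (m13 + m23 : ℝ) ≤ (n : ℝ) * (1 + Real.sqrt (2 * ((t : ℝ) - 1) * ((n : ℝ) - 1) + 1)) := by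
  classical
  set A : Finset (Fin 3 × Fin n) := {0, 1} ×ˢ Finset.univ with hA
  set B : Finset (Fin 3 × Fin n) := {2} ×ˢ Finset.univ with hB
  have hAcard : A.card = 2 * n := by simp [hA, Finset.card_product]
  have hBcard : B.card = n := by simp [hB]
  have hedges : ∑ a ∈ A, (B.bipartiteAbove G.Adj a).card = m13 + m23 := by
    rw [hm13, hm23, ← Finset.card_union_of_disjoint, ← Finset.card_sigma]
    · refine Finset.card_bij' (fun e _ => (e.1, e.2)) (fun e _ => ⟨e.1, e.2⟩) ?_ ?_ ?_ ?_ <;>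
        simp [hA, hB, Finset.mem_bipartiteAbove] <;> grind
    · refine Finset.disjoint_filter.2 fun e _ h₁ h₂ => ?_
      exact absurd (h₁.1.symm.trans h₂.1) (by decide)
  have hcommon : ∀ b ∈ B, ∀ b' ∈ B, b ≠ b' →
      (A.filter fun a => G.Adj a b ∧ G.Adj a b').card ≤ t - 1 := by
    intro b _ b' _ hne
    refine le_trans ?_ (hfree b b' hne)
    rw [← Set.ncard_coe_finset]
    refine Set.ncard_le_ncard (fun a ha => ?_) (Set.toFinite _)
    obtain ⟨-, h₁, h₂⟩ := Finset.mem_filter.1 ha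
    exact G.mem_commonNeighbors.2 ⟨h₁.symm, h₂.symm⟩
  have hquad := sq_sum_card_bipartiteAbove_le G.Adj A B (t - 1) hcommon
  rw [← Nat.cast_sum, hedges, hAcard, hBcard, Nat.cast_sub (by omega)] at hquad
  push_cast at hquad
  have hroot : (m13 + m23 : ℝ) - n ≤
      Real.sqrt ((n : ℝ) ^ 2 * (2 * ((t : ℝ) - 1) * ((n : ℝ) - 1) + 1)) :=
    Real.le_sqrt_of_sq_le (by linarith)
  rw [Real.sqrt_mul (by positivity), Real.sqrt_sq (by positivity)] at hroot
  linarith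
end

section
/- Let $t \ge 2$ be an even integer and $p$ a prime with $(t-1) \mid (p-1)$; write $p - 1 = a(t-1)$ (so $a$ is even). Let $g$ be a primitive root of the finite field $\mathbb{F}_p$, and set $B = \{g, g^2, \dots, g^{a/2}\} \subseteq \mathbb{F}_p^*$ and $W = \{a, 2a, \dots, (t-1)a\} \subseteq \mathbb{Z}$. For $f \in \mathbb{F}_p^*$, define $P_f = \{(w,b) \in W \times B : g^w b = f\}$ and $N_f = \{(w,b) \in W \times B : g^w b = -f\}$. Then for every $f \in \mathbb{F}_p^*$, exactly one of the sets $P_f, N_f$ has exactly one element and the other is empty; in particular $|P_f| + |N_f| = 1$. -/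
/-- If `s` is odd, the integers `2 * h * j + i` with `1 ≤ j ≤ s` and `1 ≤ i ≤ h` are pairwise
incongruent modulo `h * s`. -/
theorem eq_and_eq_of_two_mul_mul_add_modEq {h s i j i' j' : ℕ} (hs : Odd s)
    (hi : 1 ≤ i) (hih : i ≤ h) (hi' : 1 ≤ i') (hih' : i' ≤ h)
    (hj : 1 ≤ j) (hjs : j ≤ s) (hj' : 1 ≤ j') (hjs' : j' ≤ s)
    (H : 2 * h * j + i ≡ 2 * h * j' + i' [MOD h * s]) : i = i' ∧ j = j' := by
  have eq_of_modEq {m x y : ℕ} (hx : 1 ≤ x) (hxm : x ≤ m) (hy : 1 ≤ y) (hym : y ≤ m)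
      (hxy : x ≡ y [MOD m]) : x = y := by
    have := (Nat.ModEq.add_right_cancel' 1
      (by rwa [Nat.sub_add_cancel hx, Nat.sub_add_cancel hy]) : x - 1 ≡ y - 1 [MOD m])
    have := this.eq_of_lt_of_lt (by omega) (by omega)
    omega
  have hii : i = i' := by
    apply eq_of_modEq hi hih hi' hih'
    have := H.of_mul_right s
    simpa [Nat.ModEq, mul_assoc, mul_left_comm 2 h, Nat.mul_add_mod] using this
  subst hii
  refine ⟨rfl, eq_of_modEq hj hjs hj' hjs' ?_⟩
  have H2 := Nat.ModEq.add_right_cancel' i H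
  rw [mul_comm 2 h, mul_assoc, mul_assoc] at H2
  have H3 := Nat.ModEq.mul_left_cancel' (by omega) H2
  exact Nat.ModEq.cancel_left_of_coprime (hs.coprime_two_right) H3

/-- In a monoid, if `g ^ (a * s) = 1`, then in `g ^ (a * k + i)` the number `k` can be
replaced by some `j ∈ {1, …, s}`. -/
theorem exists_pow_mul_pow_eq {M : Type*} [Monoid M] {g : M} {a s : ℕ} (hs : 0 < s)
    (hg : g ^ (a * s) = 1) (k i : ℕ) :
    ∃ j, 1 ≤ j ∧ j ≤ s ∧ g ^ (j * a) * g ^ i = g ^ (a * k + i) := by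
  refine ⟨(k + s - 1) % s + 1, by omega, Nat.mod_lt _ hs, ?_⟩
  rw [pow_add, mul_comm _ a, pow_mul, pow_mul]
  rw [pow_mul] at hg
  rw [pow_succ, ← pow_eq_pow_mod _ hg, ← pow_succ, Nat.sub_add_cancel (by omega), pow_add, hg,
    mul_one]

/-- A primitive root of even order `2 * m` in a domain satisfies `g ^ m = -1`. -/
theorem IsPrimitiveRoot.pow_half_eq_neg_one {R : Type*} [CommRing R] [IsDomain R] {g : R} {m : ℕ}
    (hm : 0 < m) (hg : IsPrimitiveRoot g (2 * m)) : g ^ m = -1 :=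
  (hg.pow (by omega) (mul_comm 2 m)).eq_neg_one_of_two_right

/-- **Lemma on `P_f` and `N_f`.** Let `t ≥ 2` be even, `p` a prime with
`p - 1 = a(t-1)` (so `a` is even), `g` a primitive root of `𝔽_p`,
`B = {g, g², …, g^{a/2}}`, `W = {a, 2a, …, (t-1)a}`. For every `f ∈ 𝔽_p^*`, exactly one
of `P_f = {(w,b) ∈ W × B : gʷ b = f}` and `N_f = {(w,b) ∈ W × B : gʷ b = -f}` has exactly
one element while the other is empty; in particular `|P_f| + |N_f| = 1`. -/
theorem stmt_3 (t a p : ℕ) (ht : 2 ≤ t) (hteven : Even t) (hp : p.Prime)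
    (hpa : p - 1 = a * (t - 1)) (ha : Even a)
    (g : ZMod p) (hg : IsPrimitiveRoot g (p - 1))
    (W : Set ℕ) (hW : W = {w | ∃ j, 1 ≤ j ∧ j ≤ t - 1 ∧ w = j * a})
    (B : Set (ZMod p)) (hB : B = {b | ∃ i, 1 ≤ i ∧ i ≤ a / 2 ∧ b = g ^ i})
    (f : ZMod p) (hf : f ≠ 0)
    (Pf Nf : Set (ℕ × ZMod p))
    (hPf : Pf = {wb | wb.1 ∈ W ∧ wb.2 ∈ B ∧ g ^ wb.1 * wb.2 = f})
    (hNf : Nf = {wb | wb.1 ∈ W ∧ wb.2 ∈ B ∧ g ^ wb.1 * wb.2 = -f}) :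
    ((Pf.ncard = 1 ∧ Nf = ∅) ∨ (Pf = ∅ ∧ Nf.ncard = 1)) ∧ Pf.ncard + Nf.ncard = 1 := by
  have : Fact p.Prime := ⟨hp⟩
  obtain ⟨h, rfl⟩ := ha
  obtain ⟨s, rfl⟩ : ∃ s, t = s + 1 := ⟨t - 1, by omega⟩
  have hs : Odd s := by
    rcases Nat.even_or_odd s with h' | h'
    · exact absurd hteven (by simpa using h'.add_one)
    · exact h'
  rw [Nat.add_sub_cancel] at hpa hW
  rw [← two_mul] at hpa hW hB
  rw [Nat.mul_div_cancel_left h two_pos] at hB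
  have hp1 : 0 < p - 1 := by have := hp.two_le; omega
  have hh : 0 < h := by
    rcases Nat.eq_zero_or_pos h with rfl | h'
    · omega
    · exact h'
  have hs0 : 0 < s := by omega
  have hp2 : p ≠ 2 := by
    rintro rfl
    have : 2 ∣ 2 * h * s := ⟨h * s, by ring⟩
    omega
  have : NeZero (2 : ZMod p) :=
    ⟨Ring.two_ne_zero (by rwa [ZMod.ringChar_zmod_n])⟩
  rw [hpa] at hg
  have hneg : g ^ (h * s) = -1 :=
    IsPrimitiveRoot.pow_half_eq_neg_one (by positivity) (by rwa [← mul_assoc])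
  -- Squaring kills the sign, so one congruence settles both uniqueness and disjointness.
  have huniq : ∀ x ∈ W ×ˢ B, ∀ y ∈ W ×ˢ B,
      (g ^ x.1 * x.2) ^ 2 = (g ^ y.1 * y.2) ^ 2 → x = y := by
    subst hW hB
    rintro ⟨_, _⟩ ⟨⟨j, hj, hjs, rfl⟩, ⟨i, hi, hih, rfl⟩⟩
      ⟨_, _⟩ ⟨⟨j', hj', hjs', rfl⟩, ⟨i', hi', hih', rfl⟩⟩ H
    simp only [← pow_add, ← pow_mul] at H
    have hmod := (hg.isOfFinOrder (by positivity)).pow_eq_pow_iff_modEq.1 H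
    rw [← hg.eq_orderOf, mul_comm _ 2, mul_comm _ 2, mul_assoc 2 h s, mul_comm j, mul_comm j'] at hmod
    obtain ⟨rfl, rfl⟩ := eq_and_eq_of_two_mul_mul_add_modEq hs hi hih hi' hih' hj hjs hj' hjs'
      (Nat.ModEq.mul_left_cancel' two_ne_zero hmod)
    rfl
  have hex : Pf.Nonempty ∨ Nf.Nonempty := by
    have : NeZero (2 * h * s) := ⟨by positivity⟩
    obtain ⟨n, -, rfl⟩ := hg.eq_pow_of_pow_eq_one
      (show f ^ (2 * h * s) = 1 by rw [← hpa]; exact ZMod.pow_card_sub_one_eq_one hf)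
    -- Shift the exponent by a period so that it is positive before dividing by `h`.
    set n' := n + 2 * h * s - 1 with hn'
    have hpos : 0 < 2 * h * s := by positivity
    have hdiv := Nat.div_add_mod n' h
    have hgn : g ^ (h * (n' / h) + (n' % h + 1)) = g ^ n := by
      rw [← add_assoc, hdiv, hn', Nat.sub_add_cancel (by omega), pow_add, hg.pow_eq_one, mul_one]
    have hmem : g ^ (n' % h + 1) ∈ B := by
      rw [hB]; exact ⟨_, by omega, Nat.mod_lt _ hh, rfl⟩
    rcases Nat.even_or_odd (n' / h) with hq | hq
    · obtain ⟨k, hk⟩ := hq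
      obtain ⟨j, hj, hjs, hjk⟩ := exists_pow_mul_pow_eq hs0 hg.pow_eq_one k (n' % h + 1)
      refine Or.inl ⟨(j * (2 * h), g ^ (n' % h + 1)), ?_⟩
      rw [hPf]
      refine ⟨by rw [hW]; exact ⟨j, hj, hjs, rfl⟩, hmem, hjk.trans ?_⟩
      rw [← hgn, hk]
      congr 1
      ring
    · obtain ⟨k, hk⟩ := hq.add_odd hs
      obtain ⟨j, hj, hjs, hjk⟩ := exists_pow_mul_pow_eq hs0 hg.pow_eq_one k (n' % h + 1)
      refine Or.inr ⟨(j * (2 * h), g ^ (n' % h + 1)), ?_⟩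
      rw [hNf]
      refine ⟨by rw [hW]; exact ⟨j, hj, hjs, rfl⟩, hmem, hjk.trans ?_⟩
      rw [← hgn, ← neg_one_mul, ← hneg, ← pow_add]
      congr 1
      rw [mul_assoc, mul_left_comm, two_mul, ← hk]
      ring
  have hPsub : Pf.Subsingleton := by
    rw [hPf]
    rintro x ⟨hx, hx', hxf⟩ y ⟨hy, hy', hyf⟩
    exact huniq x ⟨hx, hx'⟩ y ⟨hy, hy'⟩ (by rw [hxf, hyf])
  have hNsub : Nf.Subsingleton := by
    rw [hNf]
    rintro x ⟨hx, hx', hxf⟩ y ⟨hy, hy', hyf⟩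
    exact huniq x ⟨hx, hx'⟩ y ⟨hy, hy'⟩ (by rw [hxf, hyf])
  have hdisj : ∀ x ∈ Pf, ∀ y ∈ Nf, False := by
    rw [hPf, hNf]
    rintro x ⟨hx, hx', hxf⟩ y ⟨hy, hy', hyf⟩
    obtain rfl := huniq x ⟨hx, hx'⟩ y ⟨hy, hy'⟩ (by rw [hxf, hyf, neg_sq])
    have hff : 2 * f = 0 := by linear_combination hyf - hxf
    exact (mul_ne_zero two_ne_zero hf) hff
  rcases hex with ⟨x, hx⟩ | ⟨x, hx⟩
  · obtain rfl : Nf = ∅ := Set.eq_empty_of_forall_notMem fun y hy => hdisj x hx y hy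
    have hcard : Pf.ncard = 1 := by
      rw [hPsub.eq_singleton_of_mem hx, Set.ncard_singleton]
    exact ⟨Or.inl ⟨hcard, rfl⟩, by simp [hcard]⟩
  · obtain rfl : Pf = ∅ := Set.eq_empty_of_forall_notMem fun y hy => hdisj y hy x hx
    have hcard : Nf.ncard = 1 := by
      rw [hNsub.eq_singleton_of_mem hx, Set.ncard_singleton]
    exact ⟨Or.inr ⟨rfl, hcard⟩, by simp [hcard]⟩
end

section
/- Let $t \ge 2$ be an even integer and $p$ a prime with $p - 1 = a(t-1)$, and let $g$ be a primitive root of $\mathbb{F}_p$. Suppose $f \in \mathbb{F}_p^*$ is written as $f = g^{ca+d}$ with $c \in \{1,\dots,t-1\}$ and $d \in \{1,\dots,a\}$. If $1 \le d \le a/2$, then the pair $(ca, g^d)$ is the unique element of $P_f = \{(w,b) \in W \times B : g^w b = f\}$, and $N_f = \{(w,b) \in W \times B : g^w b = -f\}$ is empty, where $B = \{g, g^2, \dots, g^{a/2}\}$ and $W = \{a, 2a, \dots, (t-1)a\}$. -/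
/-- Two numbers in `[1, n]` that are congruent modulo `n` are equal. -/
theorem Nat.ModEq.eq_of_pos_of_le {n x y : ℕ} (h : x ≡ y [MOD n]) (hx : 1 ≤ x) (hxn : x ≤ n)
    (hy : 1 ≤ y) (hyn : y ≤ n) : x = y := by
  obtain ⟨x, rfl⟩ := Nat.exists_eq_add_of_le' hx
  obtain ⟨y, rfl⟩ := Nat.exists_eq_add_of_le' hy
  rw [(Nat.ModEq.add_right_cancel' 1 h).eq_of_lt_of_lt hxn hyn]

theorem IsPrimitiveRoot.pow_eq_pow_iff_modEq {M : Type*} [CommMonoid M] {g : M} {n x y : ℕ}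
    (hg : IsPrimitiveRoot g n) (hn : n ≠ 0) : g ^ x = g ^ y ↔ x ≡ y [MOD n] := by
  have hu := hg.isUnit hn
  rw [hg.eq_orderOf, ← hu.unit_spec, orderOf_units, ← _root_.pow_eq_pow_iff_modEq, Units.ext_iff]
  simp

/-- If the squares of `g ^ (j * a + i)` and `g ^ (c * a + d)` agree, then `i = d` as soon as
`i` and `d` lie in `[1, a / 2]`. -/
theorem IsPrimitiveRoot.eq_of_sq_pow_eq_sq_pow {M : Type*} [CommMonoid M] {g : M}
    {a m i j c d : ℕ} (hg : IsPrimitiveRoot g (a * m)) (hm : a * m ≠ 0)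
    (hi : 1 ≤ i) (hia : i ≤ a / 2) (hd : 1 ≤ d) (hda : d ≤ a / 2)
    (h : (g ^ (j * a + i)) ^ 2 = (g ^ (c * a + d)) ^ 2) : i = d := by
  rw [← pow_mul, ← pow_mul, hg.pow_eq_pow_iff_modEq hm] at h
  have h' : i * 2 ≡ d * 2 [MOD a] := by
    simpa [Nat.ModEq, add_mul, mul_right_comm _ a 2] using h.of_mul_right m
  have := h'.eq_of_pos_of_le (by omega) (by omega) (by omega) (by omega)
  omega

/-- Let `t ≥ 2` be even, `p` prime with `p - 1 = a(t-1)`, `g` a primitive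
root of `𝔽_p`, `B = {g, …, g^{a/2}}`, `W = {a, 2a, …, (t-1)a}`. If `f = g^{ca+d}` with
`1 ≤ c ≤ t-1`, `1 ≤ d ≤ a`, and moreover `1 ≤ d ≤ a/2`, then
`P_f = {(ca, g^d)}` and `N_f = ∅`. -/
theorem stmt_4 (t a p : ℕ) (ht : 2 ≤ t) (hteven : Even t) (hp : p.Prime)
    (hpa : p - 1 = a * (t - 1))
    (g : ZMod p) (hg : IsPrimitiveRoot g (p - 1))
    (W : Set ℕ) (hW : W = {w | ∃ j, 1 ≤ j ∧ j ≤ t - 1 ∧ w = j * a})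
    (B : Set (ZMod p)) (hB : B = {b | ∃ i, 1 ≤ i ∧ i ≤ a / 2 ∧ b = g ^ i})
    (c d : ℕ) (hc1 : 1 ≤ c) (hc2 : c ≤ t - 1) (hd1 : 1 ≤ d) (hd2 : d ≤ a / 2)
    (f : ZMod p) (hf : f = g ^ (c * a + d))
    (Pf Nf : Set (ℕ × ZMod p))
    (hPf : Pf = {wb | wb.1 ∈ W ∧ wb.2 ∈ B ∧ g ^ wb.1 * wb.2 = f})
    (hNf : Nf = {wb | wb.1 ∈ W ∧ wb.2 ∈ B ∧ g ^ wb.1 * wb.2 = -f}) :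
    Pf = {(c * a, g ^ d)} ∧ Nf = ∅ := by
  have := Fact.mk hp
  have hp2 := hp.two_le
  rw [hpa] at hg
  have hne : a * (t - 1) ≠ 0 := by omega
  have ha : 0 < a := by omega
  have hg0 : g ≠ 0 := (hg.isUnit hne).ne_zero
  have hodd : Odd (t - 1) := Nat.Even.sub_odd (by omega) hteven odd_one
  subst hW hB hf hPf hNf
  constructor
  · ext ⟨w, b⟩
    simp only [Set.mem_ofPred_eq, Set.mem_singleton_iff, Prod.mk.injEq]
    constructor
    · rintro ⟨⟨j, hj1, hj2, rfl⟩, ⟨i, hi1, hi2, rfl⟩, h⟩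
      rw [← pow_add] at h
      obtain rfl := hg.eq_of_sq_pow_eq_sq_pow hne hi1 hi2 hd1 hd2 (congrArg (· ^ 2) h)
      rw [hg.pow_eq_pow_iff_modEq hne, mul_comm a] at h
      have hjc := Nat.ModEq.mul_right_cancel' ha.ne' (Nat.ModEq.add_right_cancel' i h)
      rw [hjc.eq_of_pos_of_le hj1 hj2 hc1 hc2]
      exact ⟨rfl, rfl⟩
    · rintro ⟨rfl, rfl⟩
      exact ⟨⟨c, hc1, hc2, rfl⟩, ⟨d, hd1, hd2, rfl⟩, (pow_add ..).symm⟩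
  · rw [Set.eq_empty_iff_forall_notMem]
    rintro ⟨w, b⟩ ⟨⟨j, hj1, hj2, hw⟩, ⟨i, hi1, hi2, hb⟩, h⟩
    dsimp only at hw hb h
    subst hw hb
    rw [← pow_add] at h
    obtain rfl := hg.eq_of_sq_pow_eq_sq_pow hne hi1 hi2 hd1 hd2 (by rw [h, neg_sq])
    rw [pow_add, pow_add, ← neg_mul] at h
    have h' := congrArg (· ^ (t - 1)) (mul_right_cancel₀ (pow_ne_zero i hg0) h)
    have hone (k : ℕ) : (g ^ (k * a)) ^ (t - 1) = 1 := by
      rw [← pow_mul, mul_assoc, mul_comm, pow_mul, hg.pow_eq_one, one_pow]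
    simp only [hodd.neg_pow, hone] at h'
    have hp3 : 2 < p := by
      have := Nat.le_mul_of_pos_right a hodd.pos
      omega
    have := Fact.mk hp3
    exact ZMod.neg_one_ne_one h'.symm
end

section
/- Let $t \ge 2$ be an even integer, $p \ge 3$ a prime with $p \equiv 1 \pmod{t-1}$, and set $n_t = \frac{p(p-1)}{2(t-1)}$. Then there exists a 3-partite graph with three parts each of size $n_t$ that contains no copy of $K_{2,t}$ and has at least $\frac{3p(p-1)^2}{4(t-1)}$ edges; equivalently, $ex(n_t, n_t, n_t, K_{2,t}) \ge \frac{3p(p-1)^2}{4(t-1)}$. -/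
theorem fin_three_ne_add_one {i j : Fin 3} : i = j + 1 → j ≠ i + 1 := by
  revert i j
  decide

section TripartiteNormGraph

variable {F Q ι : Type*} [Field F]

/-- Vertices of part `i` carry labels `(q, y) : Q × F` through `e`. Going from a part to the next one
(`ε = 1`) or to the previous one (`ε = -1`), two vertices with labels `(q, y)` and `(q', y')` are
adjacent when `ε * (y - y')` lies in the coset `r q * r q' * H`. -/
def tripartiteNormGraph (H : Subgroup Fˣ) (r : Q → Fˣ) (e : ι ≃ Q × F) :
    SimpleGraph (Fin 3 × ι) where
  Adj u w := ∃ ε : Fˣ, (ε = 1 ∧ w.1 = u.1 + 1 ∨ ε = -1 ∧ u.1 = w.1 + 1) ∧ ∃ h ∈ H,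
    (ε : F) * ((e u.2).2 - (e w.2).2) = r (e u.2).1 * r (e w.2).1 * h
  symm := ⟨by
    rintro u w ⟨ε, hε, h, hh, heq⟩
    refine ⟨-ε, ?_, h, hh, ?_⟩
    · rcases hε with ⟨rfl, h1⟩ | ⟨rfl, h1⟩
      · exact Or.inr ⟨rfl, h1⟩
      · exact Or.inl ⟨neg_neg 1, h1⟩
    · push_cast
      linear_combination heq⟩
  loopless := ⟨by
    rintro u ⟨ε, ⟨-, h1⟩ | ⟨-, h1⟩, -⟩ <;> revert h1 <;> generalize u.1 = i <;>
      revert i <;> decide⟩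

variable {H : Subgroup Fˣ} {r : Q → Fˣ} {e : ι ≃ Q × F}

theorem tripartiteNormGraph_adj_fst_ne {u w : Fin 3 × ι}
    (h : (tripartiteNormGraph H r e).Adj u w) : u.1 ≠ w.1 := by
  obtain ⟨ε, ⟨-, h1⟩ | ⟨-, h1⟩, -⟩ := h <;> revert h1 <;> generalize u.1 = i <;>
    generalize w.1 = j <;> revert i j <;> decide

/-- Two distinct vertices have at most `|H|` common neighbours, provided that the signed products
`± r q * h` are pairwise distinct. -/
theorem tripartiteNormGraph_ncard_commonNeighbors_le [Finite F]
    (hr : ∀ q q', ∀ h ∈ H, ∀ h' ∈ H, r q * h = r q' * h' → q = q')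
    (hneg : ∀ q q', ∀ h ∈ H, ∀ h' ∈ H, r q * h ≠ -(r q' * h'))
    {u v : Fin 3 × ι} (huv : u ≠ v) :
    ((tripartiteNormGraph H r e).commonNeighbors u v).ncard ≤ Nat.card H := by
  have key : ∀ w : Fin 3 × ι, ∃ (ε : Fˣ) (h k : H),
      w ∈ (tripartiteNormGraph H r e).commonNeighbors u v →
      (ε = 1 ∧ w.1 = u.1 + 1 ∨ ε = -1 ∧ u.1 = w.1 + 1) ∧
      (ε : F) * ((e u.2).2 - (e w.2).2) = r (e u.2).1 * r (e w.2).1 * (h : Fˣ) ∧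
      (ε : F) * ((e u.2).2 - (e v.2).2) = r (e w.2).1 * (h : Fˣ) *
        (r (e u.2).1 - (if u.1 = v.1 then 1 else -1) * r (e v.2).1 * (k : Fˣ)) := by
    intro w
    by_cases hw : w ∈ (tripartiteNormGraph H r e).commonNeighbors u v
    swap
    · exact ⟨1, 1, 1, fun h => absurd h hw⟩
    obtain ⟨⟨ε, hε, h, hh, heq⟩, ε', hε', h', hh', heq'⟩ := hw
    refine ⟨ε, ⟨h, hh⟩, ⟨h' * h⁻¹, H.mul_mem hh' (H.inv_mem hh)⟩, fun _ => ⟨hε, heq, ?_⟩⟩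
    have hcancel : (h : F) * ((h' * h⁻¹ : Fˣ) : F) = h' := by
      rw [← Units.val_mul, mul_comm h' h⁻¹, mul_inv_cancel_left]
    have hδ : (ε : F) = (if u.1 = v.1 then 1 else -1) * ε' := by
      rcases hε with ⟨rfl, h1⟩ | ⟨rfl, h1⟩ <;> rcases hε' with ⟨rfl, h2⟩ | ⟨rfl, h2⟩
      · rw [if_pos (add_right_cancel (h1.symm.trans h2)), one_mul]
      · rw [if_neg fun h3 => fin_three_ne_add_one h1 (h3.trans h2)]
        simp
      · rw [if_neg fun h3 => fin_three_ne_add_one h1 (h2.trans (congrArg (· + 1) h3.symm))]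
        simp
      · rw [if_pos (h1.trans h2.symm), one_mul]
    generalize (if u.1 = v.1 then (1 : F) else -1) = δ at hδ ⊢
    linear_combination heq - δ * heq' + ((e w.2).2 - (e v.2).2) * hδ +
      δ * r (e v.2).1 * r (e w.2).1 * hcancel
  choose ε h k hkey using key
  rw [← Set.ncard_univ]
  refine Set.ncard_le_ncard_of_injOn k (fun _ _ => Set.mem_univ _) ?_ (Set.toFinite _)
  intro w hw w' hw' hkk
  obtain ⟨hε, hadj, hcommon⟩ := hkey w hw
  obtain ⟨hε', hadj', hcommon'⟩ := hkey w' hw'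
  rw [← hkk] at hcommon'
  have hne : (r (e u.2).1 : F) -
      (if u.1 = v.1 then 1 else -1) * r (e v.2).1 * (k w : Fˣ) ≠ 0 := by
    intro h0
    rw [h0, mul_zero, mul_eq_zero, or_iff_right (Units.ne_zero _), sub_eq_zero] at hcommon
    split_ifs at h0 with hpart
    · refine huv (Prod.ext hpart (e.injective (Prod.ext ?_ hcommon)))
      refine hr _ _ 1 H.one_mem (k w) (k w).2 (Units.ext ?_)
      push_cast
      linear_combination h0
    · refine hneg (e u.2).1 (e v.2).1 1 H.one_mem (k w) (k w).2 (Units.ext ?_)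
      push_cast
      linear_combination h0
  have hprod : (ε w : F) * (r (e w'.2).1 * (h w' : Fˣ)) =
      ε w' * (r (e w.2).1 * (h w : Fˣ)) := by
    refine mul_right_cancel₀ hne ?_
    linear_combination ε w' * hcommon - ε w * hcommon'
  have hprod' : ε w * (r (e w'.2).1 * h w') = ε w' * (r (e w.2).1 * h w) :=
    Units.ext (by push_cast; exact hprod)
  have hεε : ε w = ε w' := by
    rcases hε with ⟨h1, -⟩ | ⟨h1, -⟩ <;> rcases hε' with ⟨h2, -⟩ | ⟨h2, -⟩ <;>
      rw [h1, h2] at hprod' ⊢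
    · rw [one_mul, neg_one_mul] at hprod'
      exact absurd hprod' (hneg _ _ _ (h w').2 _ (h w).2)
    · rw [one_mul, neg_one_mul] at hprod'
      exact absurd hprod'.symm (hneg _ _ _ (h w).2 _ (h w').2)
  rw [hεε] at hprod'
  have hrh := mul_left_cancel hprod'
  have hq : (e w'.2).1 = (e w.2).1 := hr _ _ _ (h w').2 _ (h w).2 hrh
  rw [hq] at hrh hadj'
  rw [mul_left_cancel hrh, ← hεε, ← hadj] at hadj'
  have hy : (e w'.2).2 = (e w.2).2 :=
    sub_right_injective (mul_left_cancel₀ (Units.ne_zero _) hadj')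
  refine Prod.ext ?_ (e.injective (Prod.ext hq.symm hy.symm))
  have hchar : (1 : Fˣ) ≠ -1 := fun h1 =>
    hneg (e w.2).1 (e w.2).1 1 H.one_mem 1 H.one_mem (by
      simpa using congrArg (r (e w.2).1 * ·) h1)
  rw [← hεε] at hε'
  rcases hε with ⟨h1, h3⟩ | ⟨h1, h3⟩ <;> rcases hε' with ⟨h2, h4⟩ | ⟨h2, h4⟩
  · rw [h3, h4]
  · exact absurd (h1.symm.trans h2) hchar
  · exact absurd (h2.symm.trans h1) hchar
  · exact add_right_cancel (h3.symm.trans h4)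

theorem tripartiteNormGraph_le_ncard_edgeSet [Finite F] [Finite Q] [Finite ι] :
    3 * Nat.card ι * (Nat.card Q * Nat.card H) ≤ (tripartiteNormGraph H r e).edgeSet.ncard := by
  let f : (Fin 3 × ι) × (Q × H) → Sym2 (Fin 3 × ι) := fun x =>
    s(x.1, (x.1.1 + 1, e.symm (x.2.1, (e x.1.2).2 - r (e x.1.2).1 * r x.2.1 * (x.2.2 : Fˣ))))
  have hf : Function.Injective f := by
    rintro ⟨⟨i, a⟩, q, h⟩ ⟨⟨j, b⟩, q', h'⟩ heq
    rcases Sym2.eq_iff.mp heq with ⟨h1, h2⟩ | ⟨h1, h2⟩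
    · obtain ⟨rfl, rfl⟩ : i = j ∧ a = b := Prod.ext_iff.mp h1
      obtain ⟨hq, h4⟩ := Prod.ext_iff.mp (e.symm.injective (Prod.ext_iff.mp h2).2)
      obtain rfl : q = q' := hq
      have h5 : ((h : Fˣ) : F) = (h' : Fˣ) := mul_left_cancel₀
        (mul_ne_zero (Units.ne_zero _) (Units.ne_zero _)) (sub_right_injective h4)
      rw [Subtype.ext (Units.ext h5)]
    · exact absurd (Prod.ext_iff.mp h2).1.symm (fin_three_ne_add_one (Prod.ext_iff.mp h1).1)
  have hsub : Set.range f ⊆ (tripartiteNormGraph H r e).edgeSet := by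
    rintro _ ⟨⟨⟨i, a⟩, q, h⟩, rfl⟩
    exact ⟨1, Or.inl ⟨rfl, rfl⟩, h, h.2, by simp⟩
  refine le_trans (le_of_eq ?_) (Set.ncard_le_ncard hsub (Set.toFinite _))
  rw [← Set.image_univ, Set.ncard_image_of_injective _ hf, Set.ncard_univ]
  simp [Nat.card_prod]

end TripartiteNormGraph

/-- For odd `s` with `2 * s ∣ p - 1`, the subgroup `H` of `s`-th roots of unity in `ZMod p`, with a
choice `r` of representatives modulo `2s`-th roots of unity, has distinct signed products. -/
theorem ZMod.exists_subgroup_units_and_representatives (p s : ℕ) [Fact p.Prime] (hp : p ≠ 2)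
    (hs : Odd s) (hdvd : 2 * s ∣ p - 1) :
    ∃ (H : Subgroup (ZMod p)ˣ) (r : Fin ((p - 1) / (2 * s)) → (ZMod p)ˣ), Nat.card H = s ∧
      (∀ q q', ∀ h ∈ H, ∀ h' ∈ H, r q * h = r q' * h' → q = q') ∧
      (∀ q q', ∀ h ∈ H, ∀ h' ∈ H, r q * h ≠ -(r q' * h')) := by
  have hcard : Nat.card (ZMod p)ˣ = p - 1 := by
    rw [Nat.card_eq_fintype_card, ZMod.card_units]
  let K : Subgroup (ZMod p)ˣ := (powMonoidHom (2 * s)).ker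
  have hK : Nat.card ((ZMod p)ˣ ⧸ K) = (p - 1) / (2 * s) := by
    rw [← Subgroup.index_eq_card, IsCyclic.index_powMonoidHom_ker, hcard, Nat.gcd_eq_right hdvd]
  let f := (Finite.equivFinOfCardEq hK).symm
  have hrep : ∀ q q' (h h' : (ZMod p)ˣ), h ∈ K → h' ∈ K →
      (f q).out * h = (f q').out * h' → q = q' := by
    intro q q' h h' hh hh' heq
    have hmk := congrArg (QuotientGroup.mk (s := K)) heq
    rw [QuotientGroup.mk_mul_of_mem _ hh, QuotientGroup.mk_mul_of_mem _ hh', QuotientGroup.out_eq',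
      QuotientGroup.out_eq'] at hmk
    exact f.injective hmk
  have hle : ∀ h ∈ (powMonoidHom s : (ZMod p)ˣ →* _).ker, h ∈ K := fun h hh =>
    MonoidHom.mem_ker.mpr (by
      rw [powMonoidHom_apply, mul_comm, pow_mul, show h ^ s = 1 from hh, one_pow])
  refine ⟨(powMonoidHom s).ker, fun q => (f q).out, ?_, ?_, ?_⟩
  · rw [IsCyclic.card_powMonoidHom_ker, hcard, Nat.gcd_eq_right (dvd_of_mul_left_dvd hdvd)]
  · exact fun q q' h hh h' hh' => hrep q q' h h' (hle h hh) (hle h' hh')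
  · intro q q' h hh h' hh' heq
    rw [← mul_neg] at heq
    have hh'K : -h' ∈ K := MonoidHom.mem_ker.mpr (by
      rw [powMonoidHom_apply, (even_two_mul s).neg_pow]
      exact hle h' hh')
    obtain rfl := hrep q q' h (-h') (hle h hh) hh'K heq
    have hpow : h ^ s = (-h') ^ s := congrArg (· ^ s) (mul_left_cancel heq)
    rw [hs.neg_pow, show h ^ s = 1 from hh, show h' ^ s = 1 from hh'] at hpow
    have : Fact (2 < p) := ⟨lt_of_le_of_ne (Fact.out : p.Prime).two_le hp.symm⟩
    exact ZMod.neg_one_ne_one (by simpa using (congrArg Units.val hpow).symm)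

/-- **Theorem: lower bound construction.** Let `t ≥ 2` be even, `p ≥ 3`
a prime with `p ≡ 1 (mod t-1)`, and `n_t = p(p-1)/(2(t-1))`. There is a 3-partite graph
with three parts each of size `n_t` (vertex `u` lies in part `u.1`), containing no copy
of `K_{2,t}` (every two distinct vertices have at most `t-1` common neighbours), with at
least `3p(p-1)²/(4(t-1))` edges; equivalently `ex(n_t,n_t,n_t,K_{2,t}) ≥ 3p(p-1)²/(4(t-1))`. -/
theorem stmt_6 (t p : ℕ) (ht : 2 ≤ t) (hteven : Even t) (hp : p.Prime) (hp3 : 3 ≤ p)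
    (hmod : p ≡ 1 [MOD t - 1]) :
    ∃ G : SimpleGraph (Fin 3 × Fin (p * (p - 1) / (2 * (t - 1)))),
      (∀ u v, G.Adj u v → u.1 ≠ v.1) ∧
      (∀ u v, u ≠ v → (G.commonNeighbors u v).ncard ≤ t - 1) ∧
      3 * (p : ℝ) * ((p : ℝ) - 1) ^ 2 / (4 * ((t : ℝ) - 1)) ≤ (G.edgeSet.ncard : ℝ) := by
  have : Fact p.Prime := ⟨hp⟩
  obtain ⟨s, rfl⟩ : ∃ s, t = s + 1 := ⟨t - 1, by omega⟩
  rw [Nat.add_sub_cancel] at hmod ⊢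
  have hs : Odd s := by simpa [Nat.even_add_one] using hteven
  have hdvd : 2 * s ∣ p - 1 := by
    refine Nat.Coprime.mul_dvd_of_dvd_of_dvd (Nat.coprime_two_left.mpr hs) ?_
      ((Nat.modEq_iff_dvd' hp.one_le).mp hmod.symm)
    exact (hp.even_sub_one (by omega)).two_dvd
  obtain ⟨H, r, hH, hr, hneg⟩ :=
    ZMod.exists_subgroup_units_and_representatives p s (by omega) hs hdvd
  obtain ⟨m, hm⟩ := hdvd
  have hspos : 0 < s := by omega
  have hquot : (p - 1) / (2 * s) = m := by rw [hm]; exact Nat.mul_div_cancel_left _ (by omega)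
  have hn : p * (p - 1) / (2 * s) = p * m := by
    rw [Nat.mul_div_assoc _ ⟨m, hm⟩, hquot]
  have hcard : Nat.card (Fin ((p - 1) / (2 * s)) × ZMod p) = p * (p - 1) / (2 * s) := by
    rw [hn, hquot, Nat.card_prod, Nat.card_fin, Nat.card_zmod, mul_comm]
  obtain ⟨e⟩ : Nonempty (Fin (p * (p - 1) / (2 * s)) ≃ Fin ((p - 1) / (2 * s)) × ZMod p) :=
    ⟨(Finite.equivFinOfCardEq hcard).symm⟩
  refine ⟨tripartiteNormGraph H r e, fun u v h => tripartiteNormGraph_adj_fst_ne h,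
    fun u v huv =>
      (tripartiteNormGraph_ncard_commonNeighbors_le hr hneg huv).trans_eq hH, ?_⟩
  have hedges := tripartiteNormGraph_le_ncard_edgeSet (H := H) (r := r) (e := e)
  rw [Nat.card_fin, Nat.card_fin, hH] at hedges
  refine le_trans (le_of_eq ?_) (Nat.cast_le.mpr hedges)
  have hpm : (p : ℝ) - 1 = 2 * s * m := by
    rw [← Nat.cast_one, ← Nat.cast_sub hp.one_le, hm]
    push_cast
    ring
  have hs0 : (s : ℝ) ≠ 0 := by positivity
  rw [hn, hquot, hpm, Nat.cast_succ, add_sub_cancel_right]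
  push_cast
  field_simp
  ring
end

section
/- Let $t \ge 2$ be an even integer, $p \ge 3$ a prime with $p - 1 = a(t-1)$, $g$ a primitive root of $\mathbb{F}_p$, $B = \{g, \dots, g^{a/2}\}$, $W = \{a, 2a, \dots, (t-1)a\}$. Let $G$ be the tripartite graph with parts $V_1, V_2, V_3$, each a copy of $B \times \mathbb{F}_p$, where $(b,x) \in V_i$ is adjacent to $(c,y) \in V_{i+1}$ (indices mod 3) if and only if there exists $w \in W$ with $bc = g^w(x-y)$ in $\mathbb{F}_p$. Then $G$ has exactly $\frac{3p(p-1)^2}{4(t-1)}$ edges. -/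
/-- The powers `g ^ ((j + 1) * a)`, `j < m`, of a primitive root of order `a * m` are distinct. -/
theorem IsPrimitiveRoot.succ_mul_pow_inj {F : Type*} [Field F] {g : F} {n a m : ℕ}
    (hg : IsPrimitiveRoot g n) (hn : n = a * m) (hpos : 0 < n) {i j : ℕ} (hi : i < m) (hj : j < m)
    (h : g ^ ((i + 1) * a) = g ^ ((j + 1) * a)) : i = j := by
  have ha : 0 < a := Nat.pos_of_mul_pos_right (hn ▸ hpos)
  have hg0 : g ≠ 0 := hg.ne_zero hpos.ne'
  rw [add_one_mul, add_one_mul, pow_add, pow_add] at h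
  have hij := hg.pow_inj (by rw [hn, mul_comm a]; exact Nat.mul_lt_mul_of_pos_right hi ha)
    (by rw [hn, mul_comm a]; exact Nat.mul_lt_mul_of_pos_right hj ha)
    (mul_right_cancel₀ (pow_ne_zero _ hg0) h)
  exact Nat.eq_of_mul_eq_mul_right ha hij

/-- The edge from `(i, k, x)` to part `i + 1` with second endpoint indexed by `l` and exponent
`w = (j + 1) * a`. -/
def tripartiteEdge {F : Type*} [Field F] (g : F) (a n m : ℕ)
    (e : Fin 3 × Fin n × F × Fin n × Fin m) : Sym2 (Fin 3 × Fin n × F) :=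
  s((e.1, e.2.1, e.2.2.1), (e.1 + 1, e.2.2.2.1,
    e.2.2.1 - g ^ ((e.2.1 : ℕ) + 1) * g ^ ((e.2.2.2.1 : ℕ) + 1) /
      g ^ (((e.2.2.2.2 : ℕ) + 1) * a)))

theorem tripartiteEdge_injective {F : Type*} [Field F] {g : F} {q a m : ℕ} (n : ℕ)
    (hg : IsPrimitiveRoot g q) (hq : q = a * m) (hpos : 0 < q) :
    Function.Injective (tripartiteEdge g a n m) := by
  have hg0 : g ≠ 0 := hg.ne_zero hpos.ne'
  rintro ⟨i, k, x, l, j⟩ ⟨i', k', x', l', j'⟩ h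
  simp only [tripartiteEdge, Sym2.eq_iff, Prod.mk.injEq] at h
  rcases h with ⟨⟨rfl, rfl, rfl⟩, -, rfl, h⟩ | ⟨⟨h₁, -⟩, h₂, -⟩
  · rw [sub_right_inj, div_eq_mul_inv, div_eq_mul_inv, mul_right_inj' (by simp [hg0]),
      inv_inj] at h
    have := hg.succ_mul_pow_inj hq hpos j.2 j'.2 h
    simp [Fin.ext this]
  · exfalso
    revert i i'
    decide

theorem edgeSet_eq_range_tripartiteEdge {F : Type*} [Field F] {g : F} (hg0 : g ≠ 0)
    (a n m : ℕ) :
    (SimpleGraph.fromRel (fun u v : Fin 3 × Fin n × F =>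
      v.1 = u.1 + 1 ∧ ∃ j, 1 ≤ j ∧ j ≤ m ∧
        g ^ ((u.2.1 : ℕ) + 1) * g ^ ((v.2.1 : ℕ) + 1) =
          g ^ (j * a) * (u.2.2 - v.2.2))).edgeSet = Set.range (tripartiteEdge g a n m) := by
  have key : ∀ u v : Fin 3 × Fin n × F, (v.1 = u.1 + 1 ∧ ∃ j, 1 ≤ j ∧ j ≤ m ∧
      g ^ ((u.2.1 : ℕ) + 1) * g ^ ((v.2.1 : ℕ) + 1) = g ^ (j * a) * (u.2.2 - v.2.2)) →
      s(u, v) ∈ Set.range (tripartiteEdge g a n m) := by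
    rintro ⟨i, k, x⟩ ⟨_, l, y⟩ ⟨rfl, j, hj1, hjm, h⟩
    refine ⟨(i, k, x, l, ⟨j - 1, by omega⟩), ?_⟩
    dsimp only at h
    simp [tripartiteEdge, h, Nat.sub_add_cancel hj1, hg0]
  ext e
  constructor
  · induction e with | h u v => ?_
    rw [SimpleGraph.mem_edgeSet, SimpleGraph.fromRel_adj]
    rintro ⟨-, h | h⟩
    · exact key u v h
    · rw [Sym2.eq_swap]
      exact key v u h
  · rintro ⟨⟨i, k, x, l, j⟩, rfl⟩
    rw [tripartiteEdge, SimpleGraph.mem_edgeSet, SimpleGraph.fromRel_adj]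
    refine ⟨fun h => ?_, Or.inl ⟨rfl, j + 1, by omega, by omega, ?_⟩⟩
    · have h₁ := congrArg Prod.fst h
      simp at h₁
    · have : g ^ (((j : ℕ) + 1) * a) ≠ 0 := pow_ne_zero _ hg0
      rw [sub_sub_cancel, mul_div_cancel₀ _ this]


/-- **edge count of the construction.** Let `t ≥ 2` be even, `p ≥ 3` a
prime with `p - 1 = a(t-1)`, `g` a primitive root of `𝔽_p`. The parts of the tripartite
graph are copies of `B × 𝔽_p` where `B = {g¹, …, g^{a/2}}`; we encode the element
`g^{k+1} ∈ B` by `k : Fin (a/2)`, so a vertex is a triple `(i, k, x)` with part index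
`i : Fin 3`. Vertices `(i, k, x)` and `(i+1, l, y)` are adjacent iff
`g^{k+1} · g^{l+1} = g^w (x - y)` for some `w ∈ W = {a, 2a, …, (t-1)a}`.
Then `G` has exactly `3p(p-1)²/(4(t-1))` edges. -/
theorem stmt_7 (t a p : ℕ) (ht : 2 ≤ t) (hteven : Even t) (hp : p.Prime) (hp3 : 3 ≤ p)
    (hpa : p - 1 = a * (t - 1))
    (g : ZMod p) (hg : IsPrimitiveRoot g (p - 1))
    (G : SimpleGraph (Fin 3 × Fin (a / 2) × ZMod p))
    (hG : G = SimpleGraph.fromRel (fun u v =>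
      v.1 = u.1 + 1 ∧ ∃ j, 1 ≤ j ∧ j ≤ t - 1 ∧
        g ^ ((u.2.1 : ℕ) + 1) * g ^ ((v.2.1 : ℕ) + 1) = g ^ (j * a) * (u.2.2 - v.2.2))) :
    (G.edgeSet.ncard : ℝ) = 3 * (p : ℝ) * ((p : ℝ) - 1) ^ 2 / (4 * ((t : ℝ) - 1)) := by
  have : Fact p.Prime := ⟨hp⟩
  have hpos : 0 < p - 1 := by omega
  have ha : Even a := by
    have h₁ : Even (p - 1) := hp.even_sub_one (by omega)
    rw [hpa, Nat.even_mul] at h₁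
    exact h₁.resolve_right (Nat.not_even_iff_odd.2 (Nat.Even.sub_odd (by omega) hteven odd_one))
  obtain ⟨b, rfl⟩ := ha
  have hb : (b + b) / 2 = b := by omega
  rw [hG, edgeSet_eq_range_tripartiteEdge (hg.ne_zero hpos.ne'), ← Set.image_univ,
    Set.ncard_image_of_injective _ (tripartiteEdge_injective _ hg hpa hpos), Set.ncard_univ]
  have hpa' : (p : ℝ) - 1 = (b + b) * (t - 1) := by
    have := congrArg (Nat.cast : ℕ → ℝ) hpa
    push_cast [Nat.cast_sub (show 1 ≤ p by omega), Nat.cast_sub (show 1 ≤ t by omega)] at this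
    exact this
  have ht1 : (t : ℝ) - 1 ≠ 0 := by
    have : (2 : ℝ) ≤ t := by exact_mod_cast ht
    linarith
  simp only [Nat.card_prod, Nat.card_fin, Nat.card_zmod, hb]
  push_cast [Nat.cast_sub (show 1 ≤ t by omega)]
  rw [hpa']
  field_simp
  ring
end

section
/- Let $t \ge 2$ be an even integer, $p \ge 3$ a prime with $p - 1 = a(t-1)$, $g$ a primitive root of $\mathbb{F}_p$, $B = \{g, \dots, g^{a/2}\}$, $W = \{a, 2a, \dots, (t-1)a\}$. Let $G$ be the tripartite graph with parts $V_1, V_2, V_3$, each a copy of $B \times \mathbb{F}_p$, where $(b,x) \in V_i$ is adjacent to $(c,y) \in V_{i+1}$ (indices mod 3) if and only if there exists $w \in W$ with $bc = g^w(x-y)$ in $\mathbb{F}_p$. Then $G$ contains no copy of $K_{2,t}$: every pair of distinct vertices of $G$ has at most $t-1$ common neighbours. -/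
/-- If `g` has order `a * n` with `n` odd, a product of a sign, a power `g ^ (k + 1)` with
`k < a / 2` and an `n`-th root of unity determines its three factors. -/
theorem IsPrimitiveRoot.sign_mul_pow_mul_root_inj {K : Type*} [Field K] {g : K} {a n : ℕ}
    (hn : Odd n) (hg : IsPrimitiveRoot g (a * n)) {k l : ℕ} (hk : k < a / 2) (hl : l < a / 2)
    {s s' h h' : K} (hs : s = 1 ∨ s = -1) (hs' : s' = 1 ∨ s' = -1)
    (hh : h ^ n = 1) (hh' : h' ^ n = 1)
    (heq : s * g ^ (k + 1) * h = s' * g ^ (l + 1) * h') : s = s' ∧ k = l ∧ h = h' := by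
  have hn0 : 0 < n := hn.pos
  have ha0 : 0 < a := by omega
  have hg0 : g ≠ 0 := hg.ne_zero (Nat.mul_pos ha0 hn0).ne'
  have sign_pow : ∀ {r : K}, r = 1 ∨ r = -1 → r ^ n = r := by
    rintro r (rfl | rfl)
    · exact one_pow n
    · exact hn.neg_one_pow
  have sign_sq : ∀ {r : K}, r = 1 ∨ r = -1 → r ^ 2 = 1 := by
    rintro r (rfl | rfl) <;> ring
  have hpow : s * (g ^ (k + 1)) ^ n = s' * (g ^ (l + 1)) ^ n := by
    have := congrArg (· ^ n) heq
    simpa only [mul_pow, hh, hh', mul_one, sign_pow hs, sign_pow hs'] using this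
  have hkl : k = l := by
    have hsq : g ^ (2 * n * k) = g ^ (2 * n * l) := by
      have hsq := congrArg (· ^ 2) hpow
      simp only [mul_pow, sign_sq hs, sign_sq hs', one_mul, ← pow_mul] at hsq
      refine mul_right_cancel₀ (pow_ne_zero (2 * n) hg0) ?_
      rw [← pow_add, ← pow_add]
      convert hsq using 2 <;> ring
    have hlt : ∀ {m : ℕ}, m < a / 2 → 2 * n * m < a * n := by
      intro m hm
      have : 2 * m < a := by omega
      nlinarith
    exact Nat.eq_of_mul_eq_mul_left (by omega) (hg.pow_inj (hlt hk) (hlt hl) hsq)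
  subst hkl
  have hss : s = s' := mul_right_cancel₀ (pow_ne_zero _ (pow_ne_zero _ hg0)) hpow
  subst hss
  have hs0 : s ≠ 0 := by rintro rfl; simp at hs
  exact ⟨rfl, rfl, mul_left_cancel₀ (mul_ne_zero hs0 (pow_ne_zero _ hg0)) heq⟩

/-- The sign `1` for an edge from part `i` to part `j = i + 1` and `-1` for `j = i - 1`. -/
def partSign (K : Type*) [Ring K] (i j : Fin 3) : K := if j = i + 1 then 1 else -1

theorem partSign_eq_or {K : Type*} [Ring K] (i j : Fin 3) :
    partSign K i j = 1 ∨ partSign K i j = -1 := by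
  unfold partSign; split_ifs <;> simp

theorem partSign_eq_mul {K : Type*} [Ring K] {i i' j : Fin 3} (h : j ≠ i) (h' : j ≠ i') :
    partSign K i' j = (if i = i' then 1 else -1) * partSign K i j := by
  unfold partSign
  fin_cases i <;> fin_cases i' <;> fin_cases j <;> simp_all

theorem partSign_injOn {K : Type*} [Ring K] (hK : (1 : K) ≠ -1) {i j j' : Fin 3} (h : j ≠ i)
    (h' : j' ≠ i) (heq : partSign K i j = partSign K i j') : j = j' := by
  unfold partSign at heq
  fin_cases i <;> fin_cases j <;> fin_cases j' <;> simp_all [eq_comm]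

/-- **the construction is `K_{2,t}`-free.** Let `t ≥ 2` be even, `p ≥ 3` a
prime with `p - 1 = a(t-1)`, `g` a primitive root of `𝔽_p`. The parts of the tripartite
graph are copies of `B × 𝔽_p` where `B = {g¹, …, g^{a/2}}`; we encode the element
`g^{k+1} ∈ B` by `k : Fin (a/2)`, so a vertex is a triple `(i, k, x)` with part index
`i : Fin 3`. Vertices `(i, k, x)` and `(i+1, l, y)` are adjacent iff
`g^{k+1} · g^{l+1} = g^w (x - y)` for some `w ∈ W = {a, 2a, …, (t-1)a}`.
Then every pair of distinct vertices of `G` has at most `t - 1` common neighbours. -/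
theorem stmt_8 (t a p : ℕ) (ht : 2 ≤ t) (hteven : Even t) (hp : p.Prime) (hp3 : 3 ≤ p)
    (hpa : p - 1 = a * (t - 1))
    (g : ZMod p) (hg : IsPrimitiveRoot g (p - 1))
    (G : SimpleGraph (Fin 3 × Fin (a / 2) × ZMod p))
    (hG : G = SimpleGraph.fromRel (fun u v =>
      v.1 = u.1 + 1 ∧ ∃ j, 1 ≤ j ∧ j ≤ t - 1 ∧
        g ^ ((u.2.1 : ℕ) + 1) * g ^ ((v.2.1 : ℕ) + 1) = g ^ (j * a) * (u.2.2 - v.2.2))) :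
    ∀ u v : Fin 3 × Fin (a / 2) × ZMod p, u ≠ v →
      (G.commonNeighbors u v).ncard ≤ t - 1 := by
  have : Fact p.Prime := ⟨hp⟩
  have : Fact (2 < p) := ⟨hp3⟩
  have hneg : (1 : ZMod p) ≠ -1 := (ZMod.neg_one_ne_one).symm
  have hodd : Odd (t - 1) := Nat.Even.sub_odd (by omega) hteven odd_one
  have hg0 : g ≠ 0 := hg.ne_zero (by omega)
  have hroot : ∀ j, (g ^ (j * a)) ^ (t - 1) = 1 := fun j => by
    rw [← pow_mul, mul_assoc, ← hpa, mul_comm, pow_mul, hg.pow_eq_one, one_pow]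
  rw [hpa] at hg
  have hadj : ∀ u w, G.Adj u w → w.1 ≠ u.1 ∧ ∃ h : ZMod p, h ^ (t - 1) = 1 ∧
      u.2.2 - w.2.2 =
        partSign (ZMod p) u.1 w.1 * g ^ ((u.2.1 : ℕ) + 1) * g ^ ((w.2.1 : ℕ) + 1) * h := by
    intro u w huw
    rw [hG, SimpleGraph.fromRel_adj] at huw
    obtain ⟨-, ⟨hpart, j, -, -, hj⟩ | ⟨hpart, j, -, -, hj⟩⟩ := huw
    · refine ⟨by rw [hpart]; simp, (g ^ (j * a))⁻¹, by rw [inv_pow, hroot, inv_one], ?_⟩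
      rw [partSign, if_pos hpart, one_mul, hj]
      field_simp
    · have hne : w.1 ≠ u.1 + 1 := by
        rw [hpart]; generalize w.1 = i; revert i; decide
      refine ⟨by rw [hpart]; simp, (g ^ (j * a))⁻¹, by rw [inv_pow, hroot, inv_one], ?_⟩
      rw [partSign, if_neg hne, mul_assoc (-1), mul_comm (g ^ ((u.2.1 : ℕ) + 1)), hj]
      field_simp
      ring
  intro u v huv
  set σ : ZMod p := if u.1 = v.1 then 1 else -1 with hσ
  have hσ' : σ = 1 ∨ σ = -1 := by rw [hσ]; split_ifs <;> simp
  set b := g ^ ((u.2.1 : ℕ) + 1) with hb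
  set b' := g ^ ((v.2.1 : ℕ) + 1) with hb'
  have hb0 : b ≠ 0 := pow_ne_zero _ hg0
  have hb0' : b' ≠ 0 := pow_ne_zero _ hg0
  -- the ratio of the two roots of unity attached to a common neighbour
  let f : Fin 3 × Fin (a / 2) × ZMod p → ZMod p := fun w =>
    σ * (v.2.2 - w.2.2) * b / ((u.2.2 - w.2.2) * b')
  have hnbr : ∀ w ∈ G.commonNeighbors u v, w.1 ≠ u.1 ∧ f w ^ (t - 1) = 1 ∧
      ∃ h : ZMod p, h ^ (t - 1) = 1 ∧
        u.2.2 - w.2.2 = b * (partSign (ZMod p) u.1 w.1 * g ^ ((w.2.1 : ℕ) + 1) * h) ∧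
        u.2.2 - v.2.2 =
          (b - σ * b' * f w) * (partSign (ZMod p) u.1 w.1 * g ^ ((w.2.1 : ℕ) + 1) * h) := by
    intro w hw
    obtain ⟨huw, hvw⟩ := hw
    obtain ⟨hne, h, hh, hx⟩ := hadj u w huw
    obtain ⟨hne', h', hh', hx'⟩ := hadj v w hvw
    rw [partSign_eq_mul hne hne', ← hσ, ← hb'] at hx'
    rw [← hb] at hx
    have hs0 : partSign (ZMod p) u.1 w.1 ≠ 0 := by
      rcases partSign_eq_or (K := ZMod p) u.1 w.1 with e | e <;> simp [e]
    have hc0 : g ^ ((w.2.1 : ℕ) + 1) ≠ 0 := pow_ne_zero _ hg0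
    have hh0 : h ≠ 0 := by
      rintro rfl
      rw [zero_pow hodd.pos.ne'] at hh
      exact zero_ne_one hh
    have hσσ : σ * σ = 1 := by rcases hσ' with e | e <;> simp [e]
    have hf : f w = h' / h := by
      simp only [f]
      rw [hx, hx', div_eq_div_iff
        (mul_ne_zero (mul_ne_zero (mul_ne_zero (mul_ne_zero hs0 hb0) hc0) hh0) hb0') hh0]
      linear_combination
        (partSign (ZMod p) u.1 w.1 * b' * g ^ ((w.2.1 : ℕ) + 1) * h' * b * h) * hσσ
    refine ⟨hne, by rw [hf, div_pow, hh, hh', div_one], h, hh, by rw [hx]; ring, ?_⟩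
    have hfh : f w * h = h' := by rw [hf, div_mul_cancel₀ _ hh0]
    linear_combination hx - hx' +
      σ * b' * partSign (ZMod p) u.1 w.1 * g ^ ((w.2.1 : ℕ) + 1) * hfh
  have hcoef : ∀ k : ZMod p, k ^ (t - 1) = 1 → b - σ * b' * k = 0 →
      u.1 = v.1 ∧ u.2.1 = v.2.1 := by
    intro k hk h0
    obtain ⟨h1, h2, -⟩ := hg.sign_mul_pow_mul_root_inj hodd u.2.1.isLt v.2.1.isLt
      (Or.inl rfl) hσ' (one_pow _) hk
      (show 1 * b * 1 = σ * b' * k by rw [one_mul, mul_one]; exact sub_eq_zero.mp h0)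
    refine ⟨?_, Fin.ext h2⟩
    by_contra hne
    exact hneg (h1.trans (if_neg hne))
  have hmaps : ∀ w ∈ G.commonNeighbors u v,
      f w ∈ (↑(Polynomial.nthRootsFinset (t - 1) (1 : ZMod p)) : Set (ZMod p)) := fun w hw =>
    (Polynomial.mem_nthRootsFinset hodd.pos _).mpr (hnbr w hw).2.1
  have hinj : Set.InjOn f (G.commonNeighbors u v) := by
    intro w hw z hz hwz
    obtain ⟨hne, hroot_w, h, hh, hx, hd⟩ := hnbr w hw
    obtain ⟨hne', -, h', hh', hx', hd'⟩ := hnbr z hz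
    rw [← hwz] at hd'
    have hcoef0 : b - σ * b' * f w ≠ 0 := by
      intro h0
      obtain ⟨h1, h2⟩ := hcoef _ hroot_w h0
      rw [h0, zero_mul] at hd
      exact huv (Prod.ext h1 (Prod.ext h2 (sub_eq_zero.mp hd)))
    have heq := mul_left_cancel₀ hcoef0 (hd.symm.trans hd')
    obtain ⟨h1, h2, -⟩ := hg.sign_mul_pow_mul_root_inj hodd w.2.1.isLt z.2.1.isLt
      (partSign_eq_or _ _) (partSign_eq_or _ _) hh hh' heq
    refine Prod.ext (partSign_injOn hneg hne hne' h1) (Prod.ext (Fin.ext h2) ?_)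
    rw [heq] at hx
    exact sub_right_injective (hx.trans hx'.symm)
  calc (G.commonNeighbors u v).ncard
      ≤ (↑(Polynomial.nthRootsFinset (t - 1) (1 : ZMod p)) : Set (ZMod p)).ncard :=
        Set.ncard_le_ncard_of_injOn f hmaps hinj (Finset.finite_toSet _)
    _ = (Polynomial.nthRootsFinset (t - 1) (1 : ZMod p)).card := Set.ncard_coe_finset _
    _ ≤ t - 1 := by
        classical
        rw [Polynomial.nthRootsFinset_def]
        exact (Multiset.toFinset_card_le _).trans (Polynomial.card_nthRoots _ _)
end

section
/- Let $t \ge 2$ be an even integer, $p \ge 3$ a prime with $p - 1 = a(t-1)$, $g$ a primitive root of $\mathbb{F}_p$, $B = \{g, \dots, g^{a/2}\}$, $W = \{a, 2a, \dots, (t-1)a\}$, and let $G$ be the tripartite graph on parts $V_1, V_2, V_3$, each a copy of $B \times \mathbb{F}_p$, with $(b,x) \in V_i$ adjacent to $(c,y) \in V_{i+1}$ (indices mod 3) iff $bc = g^w(x-y)$ for some $w \in W$. If $u = (b_1, x_1)$ and $v = (b_2, x_2)$ are two distinct vertices lying in the same part $V_i$, then $u$ and $v$ have at most $t-1$ common neighbours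 in $G$. -/
/-- The exponent of `-1` recording on which side of part `i` the part `j ≠ i` lies. -/
def sideExponent (i j : Fin 3) : ℕ := if j = i + 1 then 0 else 1

theorem sideExponent_lt_two (i j : Fin 3) : sideExponent i j < 2 := by
  unfold sideExponent; split <;> omega

theorem eq_of_sideExponent_eq {i j k : Fin 3} (hj : j ≠ i) (hk : k ≠ i)
    (h : sideExponent i j = sideExponent i k) : j = k := by
  unfold sideExponent at h
  revert i j k
  decide

/-- The adjacency relation of the tripartite construction, after raising the defining equation
to the `T`-th power to eliminate the factor `g ^ (j * a)` and absorb the orientation of the edge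
into a sign. -/
theorem ne_and_pow_eq_of_adj {K : Type*} [Field K] {a T : ℕ} (hT : Odd T) {g : K}
    (hg : g ^ (a * T) = 1) {m : ℕ} {u n : Fin 3 × Fin m × K}
    (h : (SimpleGraph.fromRel (fun u v : Fin 3 × Fin m × K =>
      v.1 = u.1 + 1 ∧ ∃ j, 1 ≤ j ∧ j ≤ T ∧
        g ^ ((u.2.1 : ℕ) + 1) * g ^ ((v.2.1 : ℕ) + 1) = g ^ (j * a) * (u.2.2 - v.2.2))).Adj u n) :
    n.1 ≠ u.1 ∧ (u.2.2 - n.2.2) ^ T = (g ^ T) ^ ((u.2.1 : ℕ) + 1) *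
      ((g ^ T) ^ ((n.2.1 : ℕ) + 1) * (-1) ^ sideExponent u.1 n.1) := by
  have hpow (j : ℕ) : (g ^ (j * a)) ^ T = 1 := by
    rw [← pow_mul, mul_assoc, mul_comm, pow_mul, hg, one_pow]
  rw [SimpleGraph.fromRel_adj] at h
  obtain ⟨-, ⟨h1, j, -, -, hj⟩ | ⟨h1, j, -, -, hj⟩⟩ := h
  · have hside : sideExponent u.1 n.1 = 0 := by simp [sideExponent, h1]
    refine ⟨by rw [h1]; generalize u.1 = i; revert i; decide, ?_⟩
    have := congrArg (· ^ T) hj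
    simp only [mul_pow, hpow, one_mul] at this
    rw [← this, hside, pow_zero, mul_one, pow_right_comm g T, pow_right_comm g T]
  · have hside : sideExponent u.1 n.1 = 1 := by
      rw [h1]; generalize n.1 = i; revert i; decide
    refine ⟨by rw [h1]; generalize n.1 = i; revert i; decide, ?_⟩
    have := congrArg (· ^ T) hj
    simp only [mul_pow, hpow, one_mul] at this
    rw [← neg_sub, hT.neg_pow, ← this, hside, pow_right_comm g T, pow_right_comm g T]
    ring

theorem IsPrimitiveRoot.pow_half_eq_neg_one_s9 {K : Type*} [Field K] {γ : K} {a : ℕ}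
    (hγ : IsPrimitiveRoot γ a) (ha : Even a) (ha0 : 0 < a) : γ ^ (a / 2) = -1 := by
  have h2 : a / 2 * 2 = a := Nat.div_mul_cancel ha.two_dvd
  have hsq : (γ ^ (a / 2)) ^ 2 = 1 := by rw [← pow_mul, h2, hγ.pow_eq_one]
  exact (eq_or_eq_neg_of_sq_eq_sq _ _ (hsq.trans (one_pow 2).symm)).resolve_left
    (hγ.pow_ne_one_of_pos_of_lt (by omega) (by omega))

theorem eq_and_eq_of_pow_mul_neg_one_pow_eq {K : Type*} [Field K] {γ : K} {a : ℕ}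
    (hγ : IsPrimitiveRoot γ a) (ha : Even a) {k l e f : ℕ} (hk : k < a / 2) (hl : l < a / 2)
    (he : e < 2) (hf : f < 2) (h : γ ^ (k + 1) * (-1) ^ e = γ ^ (l + 1) * (-1) ^ f) :
    k = l ∧ e = f := by
  have hγ0 : γ ≠ 0 := hγ.ne_zero (by omega)
  rw [← hγ.pow_half_eq_neg_one_s9 ha (by omega), pow_succ', pow_succ', mul_assoc, mul_assoc,
    mul_right_inj' hγ0, ← pow_mul, ← pow_mul, ← pow_add, ← pow_add] at h
  have hae := ha.two_dvd
  interval_cases e <;> interval_cases f <;>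
    have := hγ.pow_inj (by omega) (by omega) h <;> omega

theorem ncard_setOf_pow_eq_one_le {K : Type*} [Field K] {n : ℕ} (hn : 0 < n) :
    {h : K | h ^ n = 1}.ncard ≤ n := by
  classical
  have : {h : K | h ^ n = 1} = (Polynomial.nthRootsFinset n (1 : K) : Set K) := by
    ext; simp [Polynomial.mem_nthRootsFinset hn]
  rw [this, Set.ncard_coe_finset, Polynomial.nthRootsFinset]
  exact (Multiset.toFinset_card_le _).trans (Polynomial.card_nthRoots n 1)


/-- **same-part pairs.** In the tripartite construction (parts are copies
of `B × 𝔽_p`, `B = {g¹, …, g^{a/2}}` encoded by `Fin (a/2)` via `k ↦ g^{k+1}`; vertex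
`(i, k, x)` is adjacent to `(i+1, l, y)` iff `g^{k+1} g^{l+1} = g^w (x-y)` for some
`w ∈ W = {a, …, (t-1)a}`), any two distinct vertices `u ≠ v` lying in the same part
have at most `t - 1` common neighbours. -/
theorem stmt_9 (t a p : ℕ) (ht : 2 ≤ t) (hteven : Even t) (hp : p.Prime) (hp3 : 3 ≤ p)
    (hpa : p - 1 = a * (t - 1))
    (g : ZMod p) (hg : IsPrimitiveRoot g (p - 1))
    (G : SimpleGraph (Fin 3 × Fin (a / 2) × ZMod p))
    (hG : G = SimpleGraph.fromRel (fun u v =>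
      v.1 = u.1 + 1 ∧ ∃ j, 1 ≤ j ∧ j ≤ t - 1 ∧
        g ^ ((u.2.1 : ℕ) + 1) * g ^ ((v.2.1 : ℕ) + 1) = g ^ (j * a) * (u.2.2 - v.2.2)))
    (u v : Fin 3 × Fin (a / 2) × ZMod p) (huv : u ≠ v) (hsame : u.1 = v.1) :
    (G.commonNeighbors u v).ncard ≤ t - 1 := by

  have : Fact p.Prime := ⟨hp⟩
  obtain ⟨T, rfl⟩ : ∃ T, t = T + 1 := ⟨t - 1, by omega⟩
  simp only [Nat.add_sub_cancel] at *
  have hT : Odd T := by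
    rw [← Nat.not_even_iff_odd]; exact fun h => by simp [Nat.even_add_one, h] at hteven
  have ha : Even a := by
    have h : Even (a * T) := hpa ▸ hp.even_sub_one (by omega)
    exact (Nat.even_mul.mp h).resolve_right (Nat.not_even_iff_odd.mpr hT)
  rw [hpa] at hg
  have hγ : IsPrimitiveRoot (g ^ T) a := hg.pow (by omega) (mul_comm a T)
  have hg0 : g ≠ 0 := hg.ne_zero (by omega)
  set γ := g ^ T
  have hγ0 : γ ≠ 0 := pow_ne_zero _ hg0
  have hadj {w n} (h : G.Adj w n) := ne_and_pow_eq_of_adj hT hg.pow_eq_one (hG ▸ h)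
  have hsub {w n} (h : G.Adj w n) : w.2.2 - n.2.2 ≠ 0 := by
    intro h0
    have := (hadj h).2
    rw [h0, zero_pow (by omega)] at this
    exact mul_ne_zero (pow_ne_zero _ hγ0) (mul_ne_zero (pow_ne_zero _ hγ0) (by simp)) this.symm
  refine le_trans (Set.ncard_le_ncard_of_injOn
    (fun n => (g ^ ((v.2.1 : ℕ) + 1) * (u.2.2 - n.2.2)) /
      (g ^ ((u.2.1 : ℕ) + 1) * (v.2.2 - n.2.2))) ?_ ?_ (Set.toFinite _))
    (ncard_setOf_pow_eq_one_le (K := ZMod p) hT.pos)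
  · rintro n ⟨hu, hv⟩
    have hden := pow_ne_zero T (mul_ne_zero (pow_ne_zero ((u.2.1 : ℕ) + 1) hg0) (hsub hv))
    simp only [Set.mem_ofPred_eq]
    rw [div_pow, div_eq_one_iff_eq hden, mul_pow, mul_pow, (hadj hu).2, (hadj hv).2, hsame,
      pow_right_comm, pow_right_comm g _ T]
    ring
  · rintro n ⟨hu, hv⟩ n' ⟨hu', hv'⟩ h
    have hb := pow_ne_zero ((u.2.1 : ℕ) + 1) hg0
    have hb' := pow_ne_zero ((v.2.1 : ℕ) + 1) hg0
    simp only at h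
    rw [div_eq_div_iff (mul_ne_zero hb (hsub hv)) (mul_ne_zero hb (hsub hv'))] at h
    have hcross : (u.2.2 - n.2.2) * (v.2.2 - n'.2.2) = (u.2.2 - n'.2.2) * (v.2.2 - n.2.2) := by
      apply mul_left_cancel₀ (mul_ne_zero hb hb')
      linear_combination h
    have hfactor : (u.2.2 - v.2.2) * (n.2.2 - n'.2.2) = 0 := by
      linear_combination hcross
    have hy : n.2.2 = n'.2.2 := by
      refine sub_eq_zero.mp ((mul_eq_zero.mp hfactor).resolve_left fun h0 => huv ?_)
      have hx := sub_eq_zero.mp h0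
      have hpow := (hadj hu).2
      rw [hx, (hadj hv).2, hsame] at hpow
      have hb := mul_right_cancel₀ (mul_ne_zero (pow_ne_zero _ hγ0) (by simp)) hpow
      have hk := (eq_and_eq_of_pow_mul_neg_one_pow_eq (e := 0) (f := 0) hγ ha v.2.1.isLt
        u.2.1.isLt two_pos two_pos (by simpa using hb)).1
      exact Prod.ext hsame (Prod.ext (Fin.ext hk.symm) hx)
    have hc : γ ^ ((n.2.1 : ℕ) + 1) * (-1) ^ sideExponent u.1 n.1 =
        γ ^ ((n'.2.1 : ℕ) + 1) * (-1) ^ sideExponent u.1 n'.1 := by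
      apply mul_left_cancel₀ (pow_ne_zero ((u.2.1 : ℕ) + 1) hγ0)
      rw [← (hadj hu).2, ← (hadj hu').2, hy]
    obtain ⟨hk, he⟩ := eq_and_eq_of_pow_mul_neg_one_pow_eq hγ ha n.2.1.isLt n'.2.1.isLt
      (sideExponent_lt_two _ _) (sideExponent_lt_two _ _) hc
    exact Prod.ext (eq_of_sideExponent_eq (hadj hu).1 (hadj hu').1 he)
      (Prod.ext (Fin.ext hk) hy)
end

section
/- Let $t \ge 2$ be an even integer, $p \ge 3$ a prime with $p - 1 = a(t-1)$, $g$ a primitive root of $\mathbb{F}_p$, $B = \{g, \dots, g^{a/2}\}$, $W = \{a, 2a, \dots, (t-1)a\}$, and let $G$ be the tripartite graph on parts $V_1, V_2, V_3$, each a copy of $B \times \mathbb{F}_p$, with $(b,x) \in V_i$ adjacent to $(c,y) \in V_{i+1}$ (indices mod 3) iff $bc = g^w(x-y)$ for some $w \in W$. If $u = (b_1, x_1) \in V_1$ and $v = (b_2, x_2) \in V_2$ are vertices in two different parts, then $u$ and $v$ have at most $t-1$ common neighbours in $G$ (all such common neighbours lying in $V_3$). -/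
/-- Powers `g ^ (k + 1)` with `k < a / 2` lie in distinct cosets of the group of `n`-th roots
of unity, where `g` is a primitive root of order `a * n`. -/
lemma IsPrimitiveRoot.eq_of_pow_pow_eq {F : Type*} [Field F] {g : F} {a n : ℕ} (hn : 0 < n)
    (hg : IsPrimitiveRoot g (a * n)) (k l : Fin (a / 2))
    (h : ((g ^ ((k : ℕ) + 1)) ^ n) ^ 2 = ((g ^ ((l : ℕ) + 1)) ^ n) ^ 2) : k = l := by
  have hk := k.isLt
  have hl := l.isLt
  have hg0 : g ≠ 0 := hg.ne_zero (Nat.mul_pos (by omega) hn).ne'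
  have split (m : ℕ) : ((g ^ (m + 1)) ^ n) ^ 2 = g ^ (2 * m * n) * g ^ (2 * n) := by ring
  rw [split, split] at h
  have key := hg.pow_inj (Nat.mul_lt_mul_of_pos_right (by omega) hn)
    (Nat.mul_lt_mul_of_pos_right (by omega) hn) (mul_right_cancel₀ (pow_ne_zero _ hg0) h)
  have := Nat.eq_of_mul_eq_mul_right hn key
  exact Fin.ext (by omega)

/-- For odd `n`, the sum of `g ^ (l + 1)` and `γ * g ^ (k + 1)` with `k, l < a / 2` and `γ` an
`n`-th root of unity never vanishes. -/
lemma IsPrimitiveRoot.pow_add_pow_mul_ne_zero {F : Type*} [Field F] (h2 : (2 : F) ≠ 0) {g : F}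
    {a n : ℕ} (hn : Odd n) (hg : IsPrimitiveRoot g (a * n)) (k l : Fin (a / 2)) {γ : F}
    (hγ : γ ^ n = 1) : g ^ ((l : ℕ) + 1) + g ^ ((k : ℕ) + 1) * γ ≠ 0 := by
  intro h
  have hg0 : g ≠ 0 := hg.ne_zero (Nat.mul_pos (by have := k.isLt; omega) hn.pos).ne'
  have hpow : (g ^ ((l : ℕ) + 1)) ^ n = -(g ^ ((k : ℕ) + 1)) ^ n := by
    rw [eq_neg_of_add_eq_zero_left h, hn.neg_pow, mul_pow, hγ, mul_one]
  have hlk : l = k := hg.eq_of_pow_pow_eq hn.pos l k (by rw [hpow, neg_sq])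
  rw [hlk, eq_neg_iff_add_eq_zero, ← two_mul] at hpow
  exact mul_ne_zero h2 (pow_ne_zero _ (pow_ne_zero _ hg0)) hpow


/-- **different-part pairs.** In the tripartite construction (parts are
copies of `B × 𝔽_p`, `B = {g¹, …, g^{a/2}}` encoded by `Fin (a/2)` via `k ↦ g^{k+1}`;
vertex `(i, k, x)` is adjacent to `(i+1, l, y)` iff `g^{k+1} g^{l+1} = g^w (x-y)` for
some `w ∈ W = {a, …, (t-1)a}`), if `u ∈ V₁` (part index `0`) and `v ∈ V₂` (part index
`1`), then `u` and `v` have at most `t - 1` common neighbours, and every common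
neighbour lies in `V₃` (part index `2`). -/
theorem stmt_10 (t a p : ℕ) (ht : 2 ≤ t) (hteven : Even t) (hp : p.Prime) (hp3 : 3 ≤ p)
    (hpa : p - 1 = a * (t - 1))
    (g : ZMod p) (hg : IsPrimitiveRoot g (p - 1))
    (G : SimpleGraph (Fin 3 × Fin (a / 2) × ZMod p))
    (hG : G = SimpleGraph.fromRel (fun u v =>
      v.1 = u.1 + 1 ∧ ∃ j, 1 ≤ j ∧ j ≤ t - 1 ∧
        g ^ ((u.2.1 : ℕ) + 1) * g ^ ((v.2.1 : ℕ) + 1) = g ^ (j * a) * (u.2.2 - v.2.2)))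
    (u v : Fin 3 × Fin (a / 2) × ZMod p) (hu : u.1 = 0) (hv : v.1 = 1) :
    (G.commonNeighbors u v).ncard ≤ t - 1 ∧
    ∀ w ∈ G.commonNeighbors u v, w.1 = 2 := by
  obtain ⟨n, rfl⟩ : ∃ n, t = n + 1 := ⟨t - 1, by omega⟩
  rw [Nat.add_sub_cancel] at *
  have : Fact p.Prime := ⟨hp⟩
  have hn : Odd n := by grind
  rw [hpa] at hg
  have h2 : (2 : ZMod p) ≠ 0 := by
    intro h
    have := Nat.le_of_dvd two_pos ((ZMod.natCast_eq_zero_iff 2 p).1 (by exact_mod_cast h))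
    omega
  have hroot (j : ℕ) : (g ^ (j * a)) ^ n = 1 := by
    rw [← pow_mul, mul_assoc, mul_comm, pow_mul, hg.pow_eq_one, one_pow]
  have hroot0 (j : ℕ) : g ^ (j * a) ≠ 0 := fun h => by
    simpa [h, hn.pos.ne'] using hroot j
  have hcn (w) (hw : w ∈ G.commonNeighbors u v) : w.1 = 2 ∧ ∃ γ c : ZMod p, γ ^ n = 1 ∧
      c ^ n = (g ^ ((w.2.1 : ℕ) + 1)) ^ n ∧ g ^ ((v.2.1 : ℕ) + 1) * c = v.2.2 - w.2.2 ∧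
      g ^ ((u.2.1 : ℕ) + 1) * γ * c = w.2.2 - u.2.2 := by
    rw [SimpleGraph.mem_commonNeighbors, hG, SimpleGraph.fromRel_adj,
      SimpleGraph.fromRel_adj, hu, hv] at hw
    obtain ⟨⟨-, huw⟩, -, hvw⟩ := hw
    have hpart : w.1 = 2 := by
      have h1 := huw.imp And.left And.left
      have h2 := hvw.imp And.left And.left
      generalize w.1 = i at h1 h2
      revert h1 h2 i
      decide
    rw [hpart] at huw hvw
    obtain ⟨-, j, -, -, hj⟩ := hvw.resolve_right fun h => absurd h.1 (by decide)
    obtain ⟨-, k, -, -, hk⟩ := huw.resolve_left fun h => absurd h.1 (by decide)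
    have hj0 := hroot0 j
    have hk0 := hroot0 k
    refine ⟨hpart, g ^ (j * a) / g ^ (k * a), g ^ ((w.2.1 : ℕ) + 1) / g ^ (j * a), ?_, ?_, ?_, ?_⟩
    · rw [div_pow, hroot, hroot, div_one]
    · rw [div_pow, hroot, div_one]
    · rw [← mul_div_assoc, hj, mul_div_cancel_left₀ _ hj0]
    · rw [← mul_div_cancel_left₀ (w.2.2 - u.2.2) hk0, ← hk]
      generalize g ^ (j * a) = x at *
      generalize g ^ (k * a) = y at *
      field_simp
  refine ⟨?_, fun w hw => (hcn w hw).1⟩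
  choose! hpart γ c hγ hc hv' hu' using hcn
  calc (G.commonNeighbors u v).ncard
      ≤ ((Polynomial.nthRoots n (1 : ZMod p)).toFinset : Set (ZMod p)).ncard := by
        refine Set.ncard_le_ncard_of_injOn γ (fun w hw => ?_) (fun w hw z hz h => ?_)
        · exact Multiset.mem_toFinset.2 ((Polynomial.mem_nthRoots hn.pos).2 (hγ w hw))
        · have hcz : c w = c z := by
            refine mul_left_cancel₀
              (hg.pow_add_pow_mul_ne_zero h2 hn u.2.1 v.2.1 (hγ w hw)) ?_
            have hwz := hu' z hz
            rw [← h] at hwz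
            linear_combination hv' w hw + hu' w hw - hv' z hz - hwz
          have hk : w.2.1 = z.2.1 := hg.eq_of_pow_pow_eq hn.pos _ _ (by
            rw [← hc w hw, ← hc z hz, hcz])
          have hy : w.2.2 = z.2.2 := by
            have := hv' w hw
            rw [hcz, hv' z hz] at this
            exact (sub_right_injective this).symm
          exact Prod.ext ((hpart w hw).trans (hpart z hz).symm) (Prod.ext hk hy)
    _ ≤ n := by
        rw [Set.ncard_coe_finset]
        exact (Multiset.toFinset_card_le _).trans (Polynomial.card_nthRoots n 1)
end

section
/- Let $t \ge 2$ be an even integer. Then $ex(n,n,n,K_{2,t}) = 3\sqrt{\frac{t-1}{2}}\, n^{3/2} + o(n^{3/2})$ as $n \to \infty$; in particular $\lim_{n \to \infty} \frac{ex(n,n,n,K_{2,t})}{n^{3/2}} = \frac{3\sqrt{t-1}}{\sqrt{2}}$. -/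
/-- `exTri t n` is `ex(n,n,n,K_{2,t})`: the maximum number of edges in a 3-partite graph
with three parts each of size `n` (vertex `u` lies in part `u.1`) containing no copy of
`K_{2,t}`, i.e. in which every two distinct vertices have at most `t-1` common
neighbours. -/
noncomputable def exTri (t n : ℕ) : ℕ :=
  sSup {m | ∃ G : SimpleGraph (Fin 3 × Fin n),
    (∀ u v, G.Adj u v → u.1 ≠ v.1) ∧
    (∀ u v, u ≠ v → (G.commonNeighbors u v).ncard ≤ t - 1) ∧
    G.edgeSet.ncard = m}

section PrimePowers

open MeasureTheory
open scoped FourierTransform Convolution ContDiff Topology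

/-- There is a compactly supported smooth function whose Fourier transform is real-valued, nonzero
at the origin and rapidly decreasing. -/
theorem exists_contDiff_hasCompactSupport_fourier_real : ∃ (ψ : ℝ → ℂ) (p : ℝ → ℝ),
    ContDiff ℝ ∞ ψ ∧ HasCompactSupport ψ ∧ (∀ u, 𝓕 ψ u = p u) ∧ Continuous p ∧ p 0 ≠ 0 ∧
      Integrable p ∧ Integrable (fun u ↦ u ^ 2 * p u) ∧ ∃ C, ∀ u, ‖p u‖ ≤ C := by
  let b : ContDiffBump (0 : ℝ) := ⟨1, 2, by norm_num, by norm_num⟩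
  let ψ : ℝ → ℂ := fun x ↦ (b x : ℂ)
  have hψs : HasCompactSupport ψ :=
    b.hasCompactSupport.comp_left (g := fun x : ℝ ↦ (x : ℂ)) (by simp)
  have hψd : ContDiff ℝ ∞ ψ := Complex.ofRealCLM.contDiff.comp b.contDiff
  let g : SchwartzMap ℝ ℂ := hψs.toSchwartzMap hψd
  have hreal (u : ℝ) : 𝓕 ψ u = ((𝓕 ψ u).re : ℂ) := by
    refine (Complex.conj_eq_iff_re.1 ?_).symm
    rw [Real.fourier_real_eq_integral_exp_smul, ← integral_conj,
      ← integral_neg_eq_self (fun v : ℝ ↦ Complex.exp (↑(-2 * Real.pi * v * u) * Complex.I) • ψ v)]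
    refine integral_congr_ae (.of_forall fun v ↦ ?_)
    simp [ψ, ← Complex.exp_conj, b.neg, Complex.conj_ofNat]
  refine ⟨ψ, fun u ↦ (𝓕 ψ u).re, hψd, hψs, hreal, ?_, ?_, (𝓕 g).integrable.re, ?_, ?_⟩
  · exact Complex.continuous_re.comp (𝓕 g).continuous
  · have h0 : 𝓕 ψ 0 = ((∫ x, b x : ℝ) : ℂ) := by
      rw [Real.fourier_real_eq_integral_exp_smul, ← integral_complex_ofReal]
      simp [ψ]
    simp only [h0, Complex.ofReal_re]
    exact b.integral_pos.ne'
  · refine ((𝓕 g).integrable_pow_mul volume 2).mono ?_ (.of_forall fun u ↦ ?_)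
    · exact (continuous_id.pow 2).aestronglyMeasurable.mul (𝓕 g).integrable.re.aestronglyMeasurable
    · rw [norm_mul, norm_mul, norm_pow, norm_pow, norm_norm, norm_norm]
      exact mul_le_mul_of_nonneg_left (Complex.abs_re_le_norm _) (by positivity)
  · exact ⟨‖(𝓕 g).toBoundedContinuousFunction‖, fun u ↦ (Complex.abs_re_le_norm _).trans
      ((𝓕 g).toBoundedContinuousFunction.norm_coe_le_norm u)⟩

/-- The square of the Fourier transform of a continuous compactly supported function is again the
Fourier transform of such a function. -/
theorem exists_fourier_eq_sq {ψ : ℝ → ℂ} (hc : Continuous ψ) (hs : HasCompactSupport ψ) :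
    ∃ f : ℝ → ℂ, Continuous f ∧ HasCompactSupport f ∧ ∀ u, 𝓕 f u = 𝓕 ψ u ^ 2 := by
  have hi : Integrable ψ := hc.integrable_of_hasCompactSupport hs
  refine ⟨ψ ⋆[ContinuousLinearMap.mul ℂ ℂ] ψ,
    hs.continuous_convolution_right _ hi.locallyIntegrable hc, hs.convolution _ hs, fun u ↦ ?_⟩
  rw [Real.fourier_mul_convolution_eq hi hi, sq]

/-- There is a continuous compactly supported function whose Fourier transform is real-valued,
integrable with positive integral, and nonpositive far from the origin. -/
theorem exists_bandlimited_kernel_of_radius : ∃ (h : ℝ → ℂ) (k : ℝ → ℝ), Continuous h ∧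
    HasCompactSupport h ∧ (∀ u, 𝓕 h u = k u) ∧ Integrable k ∧ 0 < ∫ u, k u ∧
      ∃ R > 0, ∀ u, R ≤ |u| → k u ≤ 0 := by
  obtain ⟨ψ, p, hψd, hψs, hψp, hpc, hp0, hpi, hpi2, C, hC⟩ :=
    exists_contDiff_hasCompactSupport_fourier_real
  have hψi : Integrable ψ := hψd.continuous.integrable_of_hasCompactSupport hψs
  have hdc : Continuous (deriv ψ) := hψd.continuous_deriv (by simp)
  have hds : HasCompactSupport (deriv ψ) := hψs.deriv
  have hdi : Integrable (deriv ψ) := hdc.integrable_of_hasCompactSupport hds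
  have hq : Integrable (fun u ↦ p u ^ 2) := by
    simp_rw [sq]
    exact hpi.bdd_mul hpc.aestronglyMeasurable (.of_forall hC)
  have hq2 : Integrable (fun u ↦ u ^ 2 * p u ^ 2) := by
    refine (hpi2.bdd_mul hpc.aestronglyMeasurable (.of_forall hC)).congr (.of_forall fun u ↦ ?_)
    simp only
    ring
  have hqpos : 0 < ∫ u, p u ^ 2 := by
    rw [integral_pos_iff_support_of_nonneg (fun u ↦ sq_nonneg _) hq]
    exact (hpc.pow 2).isOpen_support.measure_pos _ ⟨0, by simpa using hp0⟩
  obtain ⟨R, hR0, hR⟩ : ∃ R : ℝ, 0 < R ∧ (∫ u, u ^ 2 * p u ^ 2) < R ^ 2 * ∫ u, p u ^ 2 := by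
    refine ⟨1 + |(∫ u, u ^ 2 * p u ^ 2) / ∫ u, p u ^ 2|, by positivity, ?_⟩
    rw [← div_lt_iff₀ hqpos]
    nlinarith [le_abs_self ((∫ u, u ^ 2 * p u ^ 2) / ∫ u, p u ^ 2),
      abs_nonneg ((∫ u, u ^ 2 * p u ^ 2) / ∫ u, p u ^ 2)]
  obtain ⟨f₁, hf₁c, hf₁s, hf₁⟩ := exists_fourier_eq_sq hψd.continuous hψs
  obtain ⟨f₂, hf₂c, hf₂s, hf₂⟩ := exists_fourier_eq_sq hdc hds
  have hs : HasCompactSupport (fun t ↦ (R : ℂ) ^ 2 * f₁ t + (4 * (Real.pi : ℂ) ^ 2)⁻¹ * f₂ t) :=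
    hf₁s.mul_left.add hf₂s.mul_left
  refine ⟨_, fun u ↦ R ^ 2 * p u ^ 2 - u ^ 2 * p u ^ 2, by fun_prop, hs, fun u ↦ ?_,
    (hq.const_mul _).sub hq2, ?_, R, hR0, ?_⟩
  · have i₁ : Integrable f₁ := hf₁c.integrable_of_hasCompactSupport hf₁s
    have i₂ : Integrable f₂ := hf₂c.integrable_of_hasCompactSupport hf₂s
    have e₁ : 𝓕 f₁ u = p u ^ 2 := by rw [hf₁, hψp]
    have e₂ : 𝓕 f₂ u = (2 * Real.pi * Complex.I * u * p u) ^ 2 := by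
      rw [hf₂, Real.fourier_deriv hψi (hψd.differentiable (by simp)) hdi]
      simp only [hψp, smul_eq_mul]
    have e : 𝓕 (fun t ↦ (R : ℂ) ^ 2 * f₁ t + (4 * (Real.pi : ℂ) ^ 2)⁻¹ * f₂ t : ℝ → ℂ) u =
        (R : ℂ) ^ 2 * 𝓕 f₁ u + (4 * (Real.pi : ℂ) ^ 2)⁻¹ * 𝓕 f₂ u := by
      have j₁ := (Real.fourierIntegral_convergent_iff u).2 i₁
      have j₂ := (Real.fourierIntegral_convergent_iff u).2 i₂
      simp only [Real.fourier_eq]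
      rw [← integral_const_mul, ← integral_const_mul,
        ← integral_add (j₁.const_mul _) (j₂.const_mul _)]
      refine integral_congr_ae (.of_forall fun t ↦ ?_)
      simp only [Circle.smul_def, smul_eq_mul]
      ring
    rw [e, e₁, e₂]
    have : (Real.pi : ℂ) ≠ 0 := by exact_mod_cast Real.pi_ne_zero
    push_cast
    simp only [mul_pow, Complex.I_sq]
    field_simp
    ring
  · rw [integral_sub (hq.const_mul _) hq2, integral_const_mul]
    linarith
  · intro u hu
    have : R ^ 2 ≤ u ^ 2 := by rw [← sq_abs u]; gcongr
    nlinarith [sq_nonneg (p u)]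

/-- For every `δ > 0` there is a continuous compactly supported function whose Fourier transform
is real-valued, integrable with positive integral, and nonpositive outside `(-δ, δ)`. -/
theorem exists_bandlimited_kernel {δ : ℝ} (hδ : 0 < δ) : ∃ (h : ℝ → ℂ) (k : ℝ → ℝ),
    Continuous h ∧ HasCompactSupport h ∧ (∀ u, 𝓕 h u = k u) ∧ Integrable k ∧ 0 < ∫ u, k u ∧
      ∀ u, δ ≤ |u| → k u ≤ 0 := by
  obtain ⟨h, k, hc, hs, hk, hki, hpos, R, hR, hneg⟩ := exists_bandlimited_kernel_of_radius
  have hr : 0 < R / δ := by positivity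
  refine ⟨fun t ↦ h ((R / δ)⁻¹ * t), fun u ↦ (R / δ) * k ((R / δ) * u), by fun_prop,
    ?_, fun u ↦ ?_, (hki.comp_mul_left' hr.ne').const_mul _, ?_, fun u hu ↦ ?_⟩
  · exact hs.comp_homeomorph (Homeomorph.mulLeft₀ _ (inv_ne_zero hr.ne'))
  · have := Measure.integral_comp_mul_left (fun t : ℝ ↦
      Complex.exp (↑(-2 * Real.pi * t * ((R / δ) * u)) * Complex.I) • h t) (R / δ)⁻¹
    rw [← Real.fourier_real_eq_integral_exp_smul, hk, inv_inv, abs_of_pos hr] at this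
    rw [Real.fourier_real_eq_integral_exp_smul, Complex.ofReal_mul, ← Complex.real_smul, ← this]
    refine integral_congr_ae (.of_forall fun t ↦ ?_)
    have : -2 * Real.pi * ((R / δ)⁻¹ * t) * ((R / δ) * u) = -2 * Real.pi * t * u := by
      field_simp
    simp only [this]
  · rw [integral_const_mul, Measure.integral_comp_mul_left, smul_eq_mul]
    positivity
  · refine mul_nonpos_of_nonneg_of_nonpos hr.le (hneg _ ?_)
    rw [abs_mul, abs_of_pos hr]
    calc R = R / δ * δ := by field_simp
      _ ≤ _ := by gcongr

open Complex

/-- Smoothing a Dirichlet series along a vertical line of absolute convergence. -/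
theorem integral_mul_LSeries_eq_tsum {a : ℕ → ℝ} {σ : ℝ}
    (ha : LSeriesSummable (fun n ↦ (a n : ℂ)) σ) {h : ℝ → ℂ} (hi : Integrable h) (L : ℝ) :
    ∫ t : ℝ, h t * LSeries (fun n ↦ (a n : ℂ)) (σ + 2 * Real.pi * t * I) *
        exp (2 * Real.pi * t * L * I) =
      ∑' n : ℕ, (if n = 0 then 0 else a n / (n : ℝ) ^ σ : ℝ) * 𝓕 h (Real.log n - L) := by
  have hb (n : ℕ) (t : ℝ) : h t * LSeries.term (fun n ↦ (a n : ℂ)) (σ + 2 * Real.pi * t * I) n *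
        exp (2 * Real.pi * t * L * I) = (if n = 0 then 0 else a n / (n : ℝ) ^ σ : ℝ) *
          (exp (↑(-2 * Real.pi * t * (Real.log n - L)) * I) • h t) := by
    rcases eq_or_ne n 0 with rfl | hn
    · simp
    · have hn0 : (n : ℂ) ≠ 0 := by exact_mod_cast hn
      have hn' : (0 : ℝ) < n := by positivity
      rw [LSeries.term_of_ne_zero hn, if_neg hn, cpow_add _ _ hn0,
        cpow_def_of_ne_zero hn0 (2 * Real.pi * t * I), ofReal_div, ofReal_cpow hn'.le,
        smul_eq_mul]
      have : exp (↑(-2 * Real.pi * t * (Real.log n - L)) * I) =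
          exp (2 * Real.pi * t * L * I) * (exp (Complex.log n * (2 * Real.pi * t * I)))⁻¹ := by
        rw [← exp_neg, ← exp_add, ← natCast_log]
        congr 1
        push_cast
        ring
      rw [this, ofReal_natCast]
      field_simp
  have hint (n : ℕ) : Integrable (fun t : ℝ ↦ h t *
      LSeries.term (fun n ↦ (a n : ℂ)) (σ + 2 * Real.pi * t * I) n *
        exp (2 * Real.pi * t * L * I)) := by
    simp only [hb]
    refine Integrable.const_mul ?_ _
    simpa [Circle.smul_def, Real.fourierChar_apply, mul_assoc, mul_comm, mul_left_comm] using
      (Real.fourierIntegral_convergent_iff (Real.log n - L)).2 hi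
  have hsum : Summable fun n : ℕ ↦ ∫ t : ℝ, ‖h t *
      LSeries.term (fun n ↦ (a n : ℂ)) (σ + 2 * Real.pi * t * I) n *
        exp (2 * Real.pi * t * L * I)‖ := by
    have : ∀ (n : ℕ) (t : ℝ), ‖h t * LSeries.term (fun n ↦ (a n : ℂ)) (σ + 2 * Real.pi * t * I) n *
        exp (2 * Real.pi * t * L * I)‖ = ‖LSeries.term (fun n ↦ (a n : ℂ)) σ n‖ * ‖h t‖ := by
      intro n t
      have : 2 * Real.pi * t * L * I = ↑(2 * Real.pi * t * L) * I := by push_cast; rfl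
      rw [norm_mul, norm_mul, this, norm_exp_ofReal_mul_I, LSeries.norm_term_eq,
        LSeries.norm_term_eq, mul_one, mul_comm]
      simp
    simp only [this, integral_const_mul]
    exact ha.norm.mul_right _
  have := integral_tsum_of_summable_integral_norm hint hsum
  simp only [tsum_mul_right, tsum_mul_left] at this
  simp only [LSeries]
  rw [← this]
  refine tsum_congr fun n ↦ ?_
  simp only [hb, integral_const_mul, Real.fourier_real_eq_integral_exp_smul]

/-- Smoothing the simple pole `1 / (s - 1)` along a vertical line. -/
theorem integral_mul_exp_div_eq {σ : ℝ} (hσ : 1 < σ) {h : ℝ → ℂ} (hi : Integrable h) (L : ℝ) :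
    ∫ t : ℝ, h t * (1 / ((σ + 2 * Real.pi * t * I) - 1)) * exp (2 * Real.pi * t * L * I) =
      ∫ v in Set.Ioi (0 : ℝ), Real.exp (-(σ - 1) * v) * 𝓕 h (v - L) := by
  have hpole (t : ℝ) : h t * (1 / ((σ + 2 * Real.pi * t * I) - 1)) * exp (2 * Real.pi * t * L * I) =
      ∫ v in Set.Ioi (0 : ℝ), Real.exp (-(σ - 1) * v) *
        (exp (↑(-2 * Real.pi * t * (v - L)) * I) • h t) := by
    have := integral_exp_mul_complex_Ioi (a := -(σ - 1 + 2 * Real.pi * t * I)) (by simpa using hσ) 0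
    rw [ofReal_zero, mul_zero, exp_zero, neg_div_neg_eq] at this
    rw [show (σ + 2 * Real.pi * t * I - 1 : ℂ) = σ - 1 + 2 * Real.pi * t * I by ring, ← this,
      mul_assoc, mul_comm, mul_assoc, ← integral_mul_const]
    refine setIntegral_congr_fun measurableSet_Ioi fun v _ ↦ ?_
    have e₁ : exp (-(σ - 1 + 2 * Real.pi * t * I) * v) =
        exp (↑(-(σ - 1) * v)) * exp (-2 * Real.pi * t * v * I) := by
      rw [← exp_add]
      congr 1
      push_cast
      ring
    have e₂ : exp (↑(-2 * Real.pi * t * (v - L)) * I) =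
        exp (-2 * Real.pi * t * v * I) * exp (2 * Real.pi * t * L * I) := by
      rw [← exp_add]
      congr 1
      push_cast
      ring
    simp only [smul_eq_mul, ofReal_exp, e₁, e₂]
    ring
  simp only [hpole]
  rw [integral_integral_swap]
  · refine setIntegral_congr_fun measurableSet_Ioi fun v _ ↦ ?_
    simp only [integral_const_mul, Real.fourier_real_eq_integral_exp_smul]
  · have hexp : Integrable (fun v : ℝ ↦ (Real.exp (-(σ - 1) * v) : ℂ))
        (volume.restrict (Set.Ioi 0)) :=
      (exp_neg_integrableOn_Ioi 0 (sub_pos.2 hσ)).ofReal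
    refine (hi.mul_prod hexp).bdd_mul (c := 1)
      (f := fun z : ℝ × ℝ ↦ exp (↑(-2 * Real.pi * z.1 * (z.2 - L)) * I)) ?_ ?_ |>.congr ?_
    · exact Continuous.aestronglyMeasurable (by fun_prop)
    · exact .of_forall fun z ↦ (norm_exp_ofReal_mul_I _).le
    · refine .of_forall fun z ↦ ?_
      simp only [Function.uncurry, smul_eq_mul]
      ring

/-- A Tauberian theorem: if a Dirichlet series with nonnegative coefficients, minus the
principal part of a simple pole at `1`, extends continuously to the closed half-plane `1 ≤ re s`,
then its coefficients do not vanish on multiplicatively short intervals. -/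
theorem eventually_exists_ne_zero_of_continuousOn {a : ℕ → ℝ} (ha : ∀ n, 0 ≤ a n)
    (hsum : ∀ σ : ℝ, 1 < σ → LSeriesSummable (fun n ↦ (a n : ℂ)) σ) {c : ℝ} (hc : 0 < c)
    {F : ℂ → ℂ} (hF : ContinuousOn F {s | 1 ≤ s.re})
    (hFeq : ∀ s : ℂ, 1 < s.re → F s = LSeries (fun n ↦ (a n : ℂ)) s - c / (s - 1))
    {δ : ℝ} (hδ : 0 < δ) :
    ∀ᶠ L : ℝ in Filter.atTop, ∃ n : ℕ, a n ≠ 0 ∧ n ≠ 0 ∧ |Real.log n - L| < δ := by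
  obtain ⟨h, k, hhc, hhs, hk, hki, hkpos, hneg⟩ := exists_bandlimited_kernel hδ
  have hi : Integrable h := hhc.integrable_of_hasCompactSupport hhs
  let E (L σ : ℝ) : ℂ :=
    ∫ t : ℝ, h t * F (σ + 2 * Real.pi * t * I) * exp (2 * Real.pi * t * L * I)
  let J (L σ : ℝ) : ℝ := ∫ v in Set.Ioi (0 : ℝ), Real.exp (-(σ - 1) * v) * k (v - L)
  have hcont (L : ℝ) : ContinuousOn
      (fun z : ℝ × ℝ ↦ h z.2 * F (z.1 + 2 * Real.pi * z.2 * I) * exp (2 * Real.pi * z.2 * L * I))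
      (Set.Ici 1 ×ˢ Set.univ) := by
    refine ContinuousOn.mul (ContinuousOn.mul (by fun_prop) ?_) (by fun_prop)
    exact hF.comp (by fun_prop) fun z hz ↦ by simpa using hz.1
  have hEcont (L : ℝ) : ContinuousOn (E L) (Set.Ici 1) :=
    continuousOn_integral_of_compact_support hhs (hcont L) fun σ t _ ht ↦ by
      simp [image_eq_zero_of_notMem_tsupport ht]
  have hkL (L : ℝ) : Integrable (fun v ↦ k (v - L)) := hki.comp_sub_right L
  have hJlim (L : ℝ) : Filter.Tendsto (J L) (𝓝[>] 1) (𝓝 (J L 1)) := by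
    refine tendsto_integral_filter_of_dominated_convergence (fun v ↦ |k (v - L)|) ?_ ?_
      (hkL L).restrict.norm ?_
    · exact .of_forall fun σ ↦ (Continuous.aestronglyMeasurable (by fun_prop)).mul
        (hkL L).restrict.aestronglyMeasurable
    · filter_upwards [self_mem_nhdsWithin] with σ hσ
      refine (ae_restrict_iff' measurableSet_Ioi).2 (.of_forall fun v hv ↦ ?_)
      rw [norm_mul, Real.norm_eq_abs, Real.abs_exp, Real.norm_eq_abs]
      refine mul_le_of_le_one_left (abs_nonneg _) (Real.exp_le_one_iff.2 ?_)
      have h1 : 0 < σ - 1 := sub_pos.2 hσ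
      have h2 : 0 < v := hv
      nlinarith
    · refine .of_forall fun v ↦ Filter.Tendsto.mono_left (Continuous.tendsto ?_ 1)
        nhdsWithin_le_nhds
      fun_prop
  have hempty (L : ℝ) (hL : ¬ ∃ n : ℕ, a n ≠ 0 ∧ n ≠ 0 ∧ |Real.log n - L| < δ) {σ : ℝ}
      (hσ : 1 < σ) : (E L σ).re + c * J L σ ≤ 0 := by
    have hEi : Integrable fun t : ℝ ↦
        h t * F (σ + 2 * Real.pi * t * I) * exp (2 * Real.pi * t * L * I) := by
      refine Continuous.integrable_of_hasCompactSupport ?_ hhs.mul_right.mul_right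
      exact (hcont L).comp_continuous (f := fun t : ℝ ↦ (σ, t)) (by fun_prop)
        fun t ↦ ⟨hσ.le, trivial⟩
    have hs (t : ℝ) : (σ + 2 * Real.pi * t * I - 1 : ℂ) ≠ 0 := fun h0 ↦ by
      have := congrArg re h0
      simp at this
      linarith
    have hPi : Integrable fun t : ℝ ↦
        h t * (1 / ((σ + 2 * Real.pi * t * I) - 1)) * exp (2 * Real.pi * t * L * I) := by
      refine Continuous.integrable_of_hasCompactSupport ?_ hhs.mul_right.mul_right
      exact (hhc.mul (continuous_const.div (by fun_prop) hs)).mul (by fun_prop)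
    have hsplit := integral_mul_LSeries_eq_tsum (hsum σ hσ) hi L
    have : ∀ t : ℝ, h t * LSeries (fun n ↦ (a n : ℂ)) (σ + 2 * Real.pi * t * I) *
        exp (2 * Real.pi * t * L * I) =
          h t * F (σ + 2 * Real.pi * t * I) * exp (2 * Real.pi * t * L * I) +
          c * (h t * (1 / ((σ + 2 * Real.pi * t * I) - 1)) * exp (2 * Real.pi * t * L * I)) := by
      intro t
      rw [hFeq _ (by simpa using hσ)]
      ring
    simp only [this] at hsplit
    rw [integral_add hEi (hPi.const_mul _), integral_const_mul,
      integral_mul_exp_div_eq hσ hi] at hsplit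
    simp only [hk, ← ofReal_mul, ← ofReal_tsum] at hsplit
    rw [integral_complex_ofReal, ← ofReal_mul] at hsplit
    have hre := congrArg re hsplit
    rw [add_re, ofReal_re, ofReal_re] at hre
    refine hre.trans_le (tsum_nonpos fun n ↦ ?_)
    split_ifs with hn
    · simp
    · by_cases han : a n = 0
      · simp [han]
      · refine mul_nonpos_of_nonneg_of_nonpos (div_nonneg (ha n) (by positivity)) (hneg _ ?_)
        by_contra! hlt
        exact hL ⟨n, han, hn, hlt⟩
  have hlim (L : ℝ) (hL : ¬ ∃ n : ℕ, a n ≠ 0 ∧ n ≠ 0 ∧ |Real.log n - L| < δ) :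
      (E L 1).re + c * J L 1 ≤ 0 := by
    refine le_of_tendsto (f := fun σ ↦ (E L σ).re + c * J L σ) (x := 𝓝[>] 1) ?_
      (Filter.eventually_of_mem self_mem_nhdsWithin fun σ hσ ↦ hempty L hL hσ)
    refine Filter.Tendsto.add ?_ ((hJlim L).const_mul c)
    exact (continuous_re.tendsto _).comp
      ((hEcont L 1 Set.self_mem_Ici).mono_left (nhdsWithin_mono _ Set.Ioi_subset_Ici_self))
  have hE0 : Filter.Tendsto (fun L ↦ E L 1) Filter.atTop (𝓝 0) := by
    have := (Real.zero_at_infty_fourier (fun t ↦ h t * F ((1 : ℝ) + 2 * Real.pi * t * I))).comp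
      ((Filter.tendsto_neg_atTop_atBot (G := ℝ)).mono_right atBot_le_cocompact)
    refine this.congr fun L ↦ ?_
    rw [Function.comp_apply, Real.fourier_real_eq_integral_exp_smul]
    refine integral_congr_ae (.of_forall fun t ↦ ?_)
    simp only [smul_eq_mul]
    rw [mul_comm]
    congr 2
    push_cast
    ring
  have hJ1 : Filter.Tendsto (fun L ↦ J L 1) Filter.atTop (𝓝 (∫ u, k u)) := by
    refine ((aecover_Ioi (μ := volume)
      (Filter.tendsto_neg_atTop_atBot (G := ℝ))).integral_tendsto_of_countably_generated
        hki).congr fun L ↦ ?_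
    simp only [J, sub_self, neg_zero, zero_mul, Real.exp_zero, one_mul]
    rw [← integral_indicator measurableSet_Ioi, ← integral_indicator measurableSet_Ioi,
      ← integral_sub_right_eq_self _ L]
    refine integral_congr_ae (.of_forall fun v ↦ ?_)
    simp [Set.indicator_apply]
  have hpos : Filter.Tendsto (fun L ↦ (E L 1).re + c * J L 1) Filter.atTop
      (𝓝 (0 + c * ∫ u, k u)) :=
    ((continuous_re.tendsto 0).comp hE0).add (hJ1.const_mul c)
  rw [zero_add] at hpos
  filter_upwards [hpos.eventually_const_lt (mul_pos hc hkpos)] with L hL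
  by_contra hne
  exact (hlim L hne).not_gt hL

/-- Prime powers congruent to `1` modulo `m` occur in all multiplicatively short intervals. -/
theorem eventually_exists_isPrimePow_modEq_one (m : ℕ) [NeZero m] {δ : ℝ} (hδ : 0 < δ) :
    ∀ᶠ L : ℝ in Filter.atTop, ∃ q : ℕ, IsPrimePow q ∧ q ≡ 1 [MOD m] ∧ |Real.log q - L| < δ := by
  have hunit : IsUnit (1 : ZMod m) := isUnit_one
  have hφ : (0 : ℝ) < (m.totient : ℝ)⁻¹ := by
    have := Nat.totient_pos.2 (NeZero.pos m)
    positivity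
  have := eventually_exists_ne_zero_of_continuousOn
    (a := ArithmeticFunction.vonMangoldt.residueClass (1 : ZMod m))
    (ArithmeticFunction.vonMangoldt.residueClass_nonneg _)
    (fun σ hσ ↦ LSeriesSummable_of_abscissaOfAbsConv_lt_re <|
      (ArithmeticFunction.vonMangoldt.abscissaOfAbsConv_residueClass_le_one _).trans_lt <| by
        simpa using mod_cast hσ)
    hφ (ArithmeticFunction.vonMangoldt.continuousOn_LFunctionResidueClassAux (1 : ZMod m))
    (fun s hs ↦ by
      rw [ArithmeticFunction.vonMangoldt.eqOn_LFunctionResidueClassAux hunit hs]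
      simp) hδ
  filter_upwards [this] with L hL
  obtain ⟨n, hn, -, hlog⟩ := hL
  have hmem := Set.mem_of_indicator_ne_zero hn
  refine ⟨n, ?_, ?_, hlog⟩
  · rw [← ArithmeticFunction.vonMangoldt_ne_zero_iff]
    rwa [ArithmeticFunction.vonMangoldt.residueClass, Set.indicator_of_mem hmem] at hn
  · rw [← ZMod.natCast_eq_natCast_iff]
    simpa using hmem

end PrimePowers

/-- Kővári–Sós–Turán type double count for the edges leaving a vertex set `A` whose neighbours
all lie in `B`. -/
theorem SimpleGraph.sq_sum_degree_le {V : Type*} [Fintype V] [DecidableEq V] (G : SimpleGraph V)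
    [DecidableRel G.Adj] (A B : Finset V) (hAB : ∀ u ∈ A, ∀ w, G.Adj u w → w ∈ B) {l : ℕ}
    (hl : ∀ u v, u ≠ v → (G.commonNeighbors u v).ncard ≤ l) :
    (∑ u ∈ A, (G.degree u : ℝ)) ^ 2 ≤
      B.card * (∑ u ∈ A, (G.degree u : ℝ) + l * (A.card : ℝ) ^ 2) := by
  let a : V → V → ℝ := fun u w => if G.Adj u w then 1 else 0
  have hdeg : ∀ u ∈ A, (G.degree u : ℝ) = ∑ w ∈ B, a u w := by
    intro u hu
    rw [Finset.sum_boole, ← G.card_neighborFinset_eq_degree]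
    congr 2
    ext w
    simpa using hAB u hu w
  have hcodeg : ∀ u ∈ A, ∀ v ∈ A,
      ∑ w ∈ B, a u w * a v w ≤ (if u = v then (G.degree u : ℝ) else 0) + l := by
    intro u hu v _
    split_ifs with h
    · subst h
      rw [hdeg u hu]
      have : ∀ w ∈ B, a u w * a u w = a u w := by
        intro w _
        simp only [a]
        split_ifs <;> simp
      rw [Finset.sum_congr rfl this]
      simp
    · have h1 : ∑ w ∈ B, a u w * a v w
          = ((B.filter fun w => G.Adj u w ∧ G.Adj v w).card : ℝ) := by
        rw [← Finset.sum_boole]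
        refine Finset.sum_congr rfl fun w _ => ?_
        by_cases h1 : G.Adj u w <;> by_cases h2 : G.Adj v w <;> simp [a, h1, h2]
      rw [h1, zero_add, Nat.cast_le]
      refine le_trans ?_ (hl u v h)
      rw [← Set.ncard_coe_finset]
      refine Set.ncard_le_ncard (fun w hw => ?_) (Set.toFinite _)
      simp only [Finset.coe_filter, Set.mem_ofPred_eq] at hw
      exact hw.2
  have hsum : ∑ u ∈ A, (G.degree u : ℝ) = ∑ w ∈ B, ∑ u ∈ A, a u w := by
    rw [Finset.sum_congr rfl hdeg, Finset.sum_comm]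
  have hsq : ∑ w ∈ B, (∑ u ∈ A, a u w) ^ 2 = ∑ u ∈ A, ∑ v ∈ A, ∑ w ∈ B, a u w * a v w := by
    simp_rw [sq, Finset.sum_mul_sum]
    rw [Finset.sum_comm]
    exact Finset.sum_congr rfl fun u _ => Finset.sum_comm
  calc (∑ u ∈ A, (G.degree u : ℝ)) ^ 2 ≤ B.card * ∑ w ∈ B, (∑ u ∈ A, a u w) ^ 2 := by
        rw [hsum]
        exact sq_sum_le_card_mul_sum_sq
    _ ≤ B.card * ∑ u ∈ A, ∑ v ∈ A, ((if u = v then (G.degree u : ℝ) else 0) + l) := by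
        rw [hsq]
        gcongr with u hu v hv
        exact hcodeg u hu v hv
    _ = _ := by
        congr 1
        simp only [Finset.sum_add_distrib, Finset.sum_ite_eq, Finset.sum_const, nsmul_eq_mul]
        rw [Finset.sum_congr rfl fun u hu => if_pos hu]
        ring

theorem le_add_sqrt_of_sq_le {x a b : ℝ} (ha : 0 ≤ a) (hb : 0 ≤ b)
    (h : x ^ 2 ≤ a * x + b) : x ≤ a + √b := by
  by_contra! hx
  have := Real.sq_sqrt hb
  have := Real.sqrt_nonneg b
  nlinarith

theorem card_edgeSet_le_of_tripartite {t n : ℕ} (G : SimpleGraph (Fin 3 × Fin n))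
    (hG : ∀ u v, G.Adj u v → u.1 ≠ v.1)
    (hc : ∀ u v, u ≠ v → (G.commonNeighbors u v).ncard ≤ t - 1) :
    (G.edgeSet.ncard : ℝ) ≤ 3 * n + 3 / 2 * √(2 * (t - 1 : ℕ) * (n : ℝ) ^ 3) := by
  classical
  let P : Fin 3 → Finset (Fin 3 × Fin n) := fun i => {i} ×ˢ Finset.univ
  let Q : Fin 3 → Finset (Fin 3 × Fin n) := fun i => {i}ᶜ ×ˢ Finset.univ
  have hP : ∀ i, (P i).card = n := by simp [P]
  have hQ : ∀ i, (Q i).card = 2 * n := by simp [Q, Finset.card_compl]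
  have hbound : ∀ i, ∑ u ∈ P i, (G.degree u : ℝ) ≤ 2 * n + √(2 * (t - 1 : ℕ) * (n : ℝ) ^ 3) := by
    intro i
    have h := G.sq_sum_degree_le (P i) (Q i) (fun u hu w huw => by
      have := hG u w huw
      simp only [P, Q, Finset.mem_product, Finset.mem_singleton, Finset.mem_univ, and_true,
        Finset.mem_compl] at hu ⊢
      rw [← hu]
      exact this.symm) hc
    rw [hP, hQ] at h
    refine le_add_sqrt_of_sq_le (by positivity) (by positivity) (h.trans_eq ?_)
    push_cast
    ring
  have htot : ∑ i : Fin 3, ∑ u ∈ P i, (G.degree u : ℝ) = 2 * G.edgeSet.ncard := by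
    rw [← Nat.card_coe_set_eq, Nat.card_eq_fintype_card, ← G.edgeFinset_card]
    have := G.sum_degrees_eq_twice_card_edges
    rw [Fintype.sum_prod_type] at this
    simp only [P, Finset.sum_product, Finset.sum_singleton]
    exact_mod_cast this
  have := Finset.sum_le_sum fun i (_ : i ∈ Finset.univ) => hbound i
  rw [htot] at this
  simp only [Finset.sum_const, Finset.card_univ, Fintype.card_fin, nsmul_eq_mul] at this
  push_cast at this
  linarith

theorem exTri_le (t n : ℕ) :
    (exTri t n : ℝ) ≤ 3 * n + 3 / 2 * √(2 * (t - 1 : ℕ) * (n : ℝ) ^ 3) := by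
  have hmem : exTri t n ≤ ⌊3 * n + 3 / 2 * √(2 * (t - 1 : ℕ) * (n : ℝ) ^ 3)⌋₊ := by
    refine csSup_le ⟨0, ⊥, by simp, by simp [SimpleGraph.commonNeighbors], by simp⟩ ?_
    rintro m ⟨G, hG, hc, rfl⟩
    exact Nat.le_floor (card_edgeSet_le_of_tripartite G hG hc)
  exact (Nat.le_floor_iff (by positivity)).1 hmem

theorem le_exTri {t n : ℕ} (G : SimpleGraph (Fin 3 × Fin n))
    (hG : ∀ u v, G.Adj u v → u.1 ≠ v.1)
    (hc : ∀ u v, u ≠ v → (G.commonNeighbors u v).ncard ≤ t - 1) :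
    G.edgeSet.ncard ≤ exTri t n := by
  refine le_csSup ⟨⌊3 * n + 3 / 2 * √(2 * (t - 1 : ℕ) * (n : ℝ) ^ 3)⌋₊, ?_⟩ ⟨G, hG, hc, rfl⟩
  rintro m ⟨G, hG, hc, rfl⟩
  exact Nat.le_floor (card_edgeSet_le_of_tripartite G hG hc)

theorem SimpleGraph.commonNeighbors_map_ncard_le {V W : Type*} [Finite V] (G : SimpleGraph V)
    (f : V ↪ W) {l : ℕ} (hl : ∀ u v, u ≠ v → (G.commonNeighbors u v).ncard ≤ l) (u v : W)
    (huv : u ≠ v) : ((G.map f).commonNeighbors u v).ncard ≤ l := by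
  rcases ((G.map f).commonNeighbors u v).eq_empty_or_nonempty with h | ⟨w, hw⟩
  · simp [h]
  · obtain ⟨h1, h2⟩ := hw
    rw [SimpleGraph.mem_neighborSet, SimpleGraph.map_adj] at h1 h2
    obtain ⟨a, _, _, rfl, _⟩ := h1
    obtain ⟨b, _, _, rfl, _⟩ := h2
    have hab : a ≠ b := fun h => huv (h ▸ rfl)
    refine le_trans ?_ (hl a b hab)
    have hsub : (G.map f).commonNeighbors (f a) (f b) ⊆ f '' G.commonNeighbors a b := by
      rintro w ⟨h1, h2⟩
      rw [SimpleGraph.mem_neighborSet, SimpleGraph.map_adj] at h1 h2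
      obtain ⟨a', c, hc, ha, rfl⟩ := h1
      obtain ⟨b', c', hc', hb, hcc⟩ := h2
      obtain rfl := f.injective ha
      obtain rfl := f.injective hb
      obtain rfl := f.injective hcc
      exact ⟨c', ⟨hc, hc'⟩, rfl⟩
    exact (Set.ncard_le_ncard hsub (Set.toFinite _)).trans (Set.ncard_image_le (Set.toFinite _))

theorem card_edgeSet_le_exTri {X : Type*} [Finite X] {t n : ℕ} (hX : Nat.card X ≤ n)
    (G : SimpleGraph (Fin 3 × X)) (hG : ∀ u v, G.Adj u v → u.1 ≠ v.1)
    (hc : ∀ u v, u ≠ v → (G.commonNeighbors u v).ncard ≤ t - 1) :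
    G.edgeSet.ncard ≤ exTri t n := by
  have : Fintype X := Fintype.ofFinite X
  obtain ⟨e⟩ : Nonempty (X ↪ Fin n) :=
    Function.Embedding.nonempty_of_card_le (by simpa [Nat.card_eq_fintype_card] using hX)
  let f : Fin 3 × X ↪ Fin 3 × Fin n := (Function.Embedding.refl _).prodMap e
  have h := le_exTri (G.map f) (t := t) ?_ (G.commonNeighbors_map_ncard_le f hc)
  · rwa [SimpleGraph.edgeSet_map, Set.ncard_image_of_injective _ f.sym2Map.injective] at h
  · intro u v huv
    rw [SimpleGraph.map_adj] at huv
    obtain ⟨a, b, hab, rfl, rfl⟩ := huv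
    exact hG a b hab

section Construction

variable {F : Type*} [Field F]

/-- The standard symplectic form on `F × F`, on vectors with nonzero first coordinate. -/
def sympForm (x y : Fˣ × F) : F := x.1 * y.2 - x.2 * y.1

theorem sympForm_neg_left (x y : Fˣ × F) : sympForm (-x.1, -x.2) y = sympForm y x := by
  simp only [sympForm, Units.val_neg]
  ring

theorem sympForm_neg_right (x y : Fˣ × F) : sympForm x (-y.1, -y.2) = sympForm y x := by
  simp only [sympForm, Units.val_neg]
  ring

/-- The image in the field of a subgroup of its units. -/
def unitsImage (H : Subgroup Fˣ) : Set F := Units.val '' (H : Set Fˣ)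

theorem ncard_unitsImage (H : Subgroup Fˣ) : (unitsImage H).ncard = Nat.card H := by
  rw [unitsImage, Set.ncard_image_of_injective _ Units.val_injective, ← Nat.card_coe_set_eq]
  rfl

theorem ncard_sympForm_mem_le [Finite F] (H : Subgroup Fˣ) (T : Set Fˣ)
    (hT : ∀ h ∈ H, ∀ u ∈ T, h * u ∈ T → h = 1) {x x' : Fˣ × F} (hx : x.1 ∈ T) (hx' : x'.1 ∈ T)
    (hne : x ≠ x') :
    {y : Fˣ × F | y.1 ∈ T ∧ sympForm x y ∈ unitsImage H ∧ sympForm x' y ∈ unitsImage H}.ncard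
      ≤ Nat.card H := by
  rw [← ncard_unitsImage]
  refine Set.ncard_le_ncard_of_injOn (fun y => sympForm x y / sympForm x' y) ?_ ?_ (Set.toFinite _)
  · rintro y ⟨_, ⟨a, ha, hxa⟩, ⟨b, hb, hxb⟩⟩
    exact ⟨a / b, H.div_mem ha hb, by simp [← hxa, ← hxb]⟩
  · rintro y ⟨hy, ⟨a, ha, hxa⟩, ⟨b, hb, hxb⟩⟩ z ⟨hz, ⟨c, hc, hxc⟩, ⟨d, hd, hxd⟩⟩ hyz
    simp only [← hxa, ← hxb, ← hxc, ← hxd] at hyz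
    have hcd : (c : F) * b = a * d := by
      rw [div_eq_div_iff b.ne_zero d.ne_zero] at hyz
      exact hyz.symm
    set g : Fˣ := d / b with hg
    have hgb : (d : F) = g * b := by simp [hg]
    have hga : (c : F) = g * a := by
      have hb0 := b.ne_zero
      rw [hg, Units.val_div_eq_div_val]
      field_simp
      linear_combination hcd
    have hgH : g ∈ H := H.div_mem hd hb
    simp only [sympForm] at hxa hxb hxc hxd
    have h1 : (x.1 : F) * (z.2 - g * y.2) = x.2 * (z.1 - g * y.1) := by
      linear_combination -hxc + g * hxa + hga
    have h2 : (x'.1 : F) * (z.2 - g * y.2) = x'.2 * (z.1 - g * y.1) := by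
      linear_combination -hxd + g * hxb + hgb
    by_cases hd1 : (z.1 : F) - g * y.1 = 0
    · have hzy : g * y.1 = z.1 := Units.ext (by push_cast; linear_combination -hd1)
      have hg1 : g = 1 := hT g hgH _ hy (hzy ▸ hz)
      rw [hd1, mul_zero, mul_eq_zero, or_iff_right x.1.ne_zero, hg1] at h1
      rw [hg1, one_mul] at hzy
      exact Prod.ext hzy (by push_cast at h1; linear_combination -h1)
    · exfalso
      apply hne
      have hprop : (x.1 : F) * x'.2 = x'.1 * x.2 := by
        apply mul_right_cancel₀ hd1
        linear_combination (x'.1 : F) * h1 - x.1 * h2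
      have hab : (x.1 : F) * b = x'.1 * a := by
        linear_combination (x.1 : F) * hxb - x'.1 * hxa - (y.1 : F) * hprop
      have hu : (a / b) * x'.1 = x.1 := by
        apply Units.ext
        have := b.ne_zero
        push_cast
        field_simp
        linear_combination -hab
      have h1 : a / b = 1 := hT _ (H.div_mem ha hb) _ hx' (hu ▸ hx)
      rw [h1, one_mul] at hu
      refine Prod.ext hu.symm ?_
      rw [hu] at hprop
      exact (mul_left_cancel₀ x.1.ne_zero hprop).symm

variable (H K : Subgroup Fˣ)

/-- The vector attached to a vertex: the first coordinate is the chosen coset representative. -/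
noncomputable def repVector (x : (Fˣ ⧸ K) × F) : Fˣ × F := (x.1.out, x.2)

theorem repVector_injective : Function.Injective (repVector K) := by
  rintro ⟨a, b⟩ ⟨c, d⟩ h
  simp only [repVector, Prod.mk.injEq] at h
  exact Prod.ext (Quotient.out_injective h.1) h.2

/-- Three cyclically arranged copies of `(Fˣ ⧸ K) × F`, each joined to the next one whenever the
symplectic form takes a value in `H`. -/
def cyclicSympGraph : SimpleGraph (Fin 3 × ((Fˣ ⧸ K) × F)) where
  Adj u v :=
    (v.1 = u.1 + 1 ∧ sympForm (repVector K u.2) (repVector K v.2) ∈ unitsImage H) ∨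
    (u.1 = v.1 + 1 ∧ sympForm (repVector K v.2) (repVector K u.2) ∈ unitsImage H)
  symm := ⟨fun _ _ h => h.symm⟩
  loopless := ⟨fun u h => by
    have : ∀ i : Fin 3, i ≠ i + 1 := by decide
    rcases h with h | h <;> exact this _ h.1⟩

theorem cyclicSympGraph_adj_fst_ne {u v : Fin 3 × ((Fˣ ⧸ K) × F)}
    (h : (cyclicSympGraph H K).Adj u v) : u.1 ≠ v.1 := by
  have key : ∀ i j : Fin 3, j = i + 1 ∨ i = j + 1 → i ≠ j := by decide
  exact key _ _ (h.imp And.left And.left)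

/-- Coset representatives of `K` together with their negatives. -/
def signedReps : Set Fˣ := {u | ∃ c : Fˣ ⧸ K, u = c.out ∨ u = -c.out}

variable {H K}

theorem mk_eq_of_eq_or_neg (hneg : -1 ∈ K) {u : Fˣ} {c : Fˣ ⧸ K} (h : u = c.out ∨ u = -c.out) :
    (u : Fˣ ⧸ K) = c := by
  rcases h with rfl | rfl
  · simp
  · conv_rhs => rw [← QuotientGroup.out_eq' c]
    rw [QuotientGroup.eq]
    have : (-c.out)⁻¹ * c.out = -1 := by
      rw [inv_neg, neg_mul, inv_mul_cancel]
    rw [this]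
    exact hneg

theorem eq_one_of_mul_mem_signedReps (hHK : H ≤ K) (hneg : -1 ∈ K) (hnegH : -1 ∉ H) :
    ∀ h ∈ H, ∀ u ∈ signedReps K, h * u ∈ signedReps K → h = 1 := by
  rintro h hh u ⟨c, hc⟩ ⟨d, hd⟩
  have hcd : c = d := by
    rw [← mk_eq_of_eq_or_neg hneg hc, ← mk_eq_of_eq_or_neg hneg hd, QuotientGroup.eq]
    have : u⁻¹ * (h * u) = h := by
      rw [mul_comm h, inv_mul_cancel_left]
    rw [this]
    exact hHK hh
  subst hcd
  have hor : h * u = u ∨ h * u = -u := by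
    rcases hc with hc | hc <;> rcases hd with hd | hd <;> rw [hd, hc] <;> simp
  rcases hor with h1 | h1
  · exact mul_eq_right.1 h1
  · rw [neg_eq_neg_one_mul] at h1
    exact absurd (mul_right_cancel h1 ▸ hh) hnegH

theorem ncard_commonNeighbors_cyclicSympGraph_le [Finite F] (hHK : H ≤ K) (hneg : -1 ∈ K)
    (hnegH : -1 ∉ H) (u v : Fin 3 × ((Fˣ ⧸ K) × F)) (huv : u ≠ v) :
    ((cyclicSympGraph H K).commonNeighbors u v).ncard ≤ Nat.card H := by
  have hT := eq_one_of_mul_mem_signedReps hHK hneg hnegH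
  have hmem : ∀ x : (Fˣ ⧸ K) × F, (repVector K x).1 ∈ signedReps K :=
    fun x => ⟨x.1, Or.inl rfl⟩
  have hmem' : ∀ x : (Fˣ ⧸ K) × F, -(repVector K x).1 ∈ signedReps K :=
    fun x => ⟨x.1, Or.inr rfl⟩
  have hdisj : ∀ x y : (Fˣ ⧸ K) × F, (repVector K x).1 ≠ -(repVector K y).1 := by
    intro x y h
    have hxy : x.1 = y.1 := by
      rw [← mk_eq_of_eq_or_neg hneg (c := x.1) (Or.inl rfl),
        ← mk_eq_of_eq_or_neg hneg (c := y.1) (Or.inr rfl)]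
      exact congrArg _ h
    simp only [repVector, hxy] at h
    rw [neg_eq_neg_one_mul, eq_comm, mul_eq_right] at h
    rw [h] at hnegH
    exact hnegH H.one_mem
  have hcross : ∀ u v : Fin 3 × ((Fˣ ⧸ K) × F), v.1 = u.1 + 1 →
      ((cyclicSympGraph H K).commonNeighbors u v).ncard ≤ Nat.card H := by
    rintro ⟨i, x⟩ ⟨j, y⟩ hij
    have hne : (-(repVector K x).1, -(repVector K x).2) ≠ repVector K y :=
      fun h => hdisj y x (congrArg Prod.fst h).symm
    refine le_trans (Set.ncard_le_ncard_of_injOn (fun w => repVector K w.2) ?_ ?_ (Set.toFinite _))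
      (ncard_sympForm_mem_le H _ hT (x := (-(repVector K x).1, -(repVector K x).2)) (hmem' x)
        (hmem y) hne)
    · rintro ⟨k, z⟩ ⟨h1, h2⟩
      subst hij
      rcases h1 with ⟨hk, hx⟩ | ⟨hk, hx⟩ <;> rcases h2 with ⟨hk', hy⟩ | ⟨hk', hy⟩
      · exact absurd (hk.symm.trans hk') (by simp)
      · exact absurd (hk.symm.trans (add_right_cancel hk').symm) (by simp)
      · exact ⟨hmem z, by rwa [sympForm_neg_left], hy⟩
      · exact absurd (hk.trans hk'.symm) (by simp)
    · rintro ⟨k, z⟩ ⟨h1, h2⟩ ⟨k', z'⟩ ⟨h1', h2'⟩ h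
      have hk : ∀ i k : Fin 3, (k = i + 1 ∨ i = k + 1) → (k = i + 1 + 1 ∨ i + 1 = k + 1) →
          k = i + 2 := by decide
      subst hij
      obtain rfl := hk i k (h1.imp And.left And.left) (h2.imp And.left And.left)
      obtain rfl := hk i k' (h1'.imp And.left And.left) (h2'.imp And.left And.left)
      exact Prod.ext rfl (repVector_injective K h)
  have hthree : ∀ i j : Fin 3, i = j ∨ j = i + 1 ∨ i = j + 1 := by decide
  rcases hthree u.1 v.1 with h | h | h
  · obtain ⟨i, x⟩ := u
    obtain ⟨j, y⟩ := v
    obtain rfl : i = j := h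
    have hne : repVector K x ≠ repVector K y :=
      fun h => huv (by rw [repVector_injective K h])
    refine le_trans (Set.ncard_le_ncard_of_injOn (fun w => if w.1 = i + 1 then repVector K w.2 else
      (-(repVector K w.2).1, -(repVector K w.2).2)) ?_ ?_ (Set.toFinite _))
      (ncard_sympForm_mem_le H _ hT (hmem x) (hmem y) hne)
    · rintro ⟨k, z⟩ ⟨h1, h2⟩
      have hk : ∀ i k : Fin 3, i = k + 1 → k ≠ i + 1 := by decide
      rcases h1 with ⟨hk1, hx⟩ | ⟨hk1, hx⟩ <;> rcases h2 with ⟨hk2, hy⟩ | ⟨hk2, hy⟩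
      · simp only [if_pos hk1]
        exact ⟨hmem z, hx, hy⟩
      · exact absurd hk1 (hk i k hk2)
      · exact absurd hk2 (hk i k hk1)
      · simp only [if_neg (hk i k hk1)]
        exact ⟨hmem' z, by rwa [sympForm_neg_right], by rwa [sympForm_neg_right]⟩
    · rintro ⟨k, z⟩ ⟨h1, h2⟩ ⟨k', z'⟩ ⟨h1', h2'⟩ h
      have hk : ∀ i k k' : Fin 3, (k = i + 1 ∨ i = k + 1) → (k' = i + 1 ∨ i = k' + 1) →
          (k = i + 1 ↔ k' = i + 1) → k = k' := by decide
      have hkk := hk i k k' (h1.imp And.left And.left) (h1'.imp And.left And.left)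
      dsimp only at h
      split_ifs at h with h3 h4 h4
      · rw [repVector_injective K h, hkk (by tauto)]
      · exact absurd (congrArg Prod.fst h) (hdisj _ _)
      · exact absurd (congrArg Prod.fst h).symm (hdisj _ _)
      · simp only [Prod.mk.injEq, neg_inj] at h
        rw [repVector_injective K (Prod.ext h.1 h.2), hkk (by tauto)]
  · exact hcross u v h
  · rw [SimpleGraph.commonNeighbors_symm]
    exact hcross v u h

theorem le_ncard_edgeSet_cyclicSympGraph [Finite F] :
    3 * (Nat.card (Fˣ ⧸ K) * Nat.card F) * Nat.card (Fˣ ⧸ K) * Nat.card H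
      ≤ (cyclicSympGraph H K).edgeSet.ncard := by
  let second : (((Fˣ ⧸ K) × F) × (Fˣ ⧸ K) × H) → F :=
    fun p => ((p.2.2 : Fˣ) + p.1.2 * (p.2.1.out : Fˣ)) / (p.1.1.out : Fˣ)
  let f : Fin 3 × (((Fˣ ⧸ K) × F) × (Fˣ ⧸ K) × H) → (cyclicSympGraph H K).edgeSet :=
    fun p => ⟨s((p.1, p.2.1), (p.1 + 1, (p.2.2.1, second p.2))), by
      rw [SimpleGraph.mem_edgeSet]
      refine Or.inl ⟨rfl, (p.2.2.2 : Fˣ), p.2.2.2.2, ?_⟩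
      have := (p.2.1.1.out : Fˣ).ne_zero
      simp only [sympForm, repVector, second]
      field_simp
      ring⟩
  have hf : Function.Injective f := by
    rintro ⟨i, x, c, h⟩ ⟨i', x', c', h'⟩ heq
    have heq := congrArg Subtype.val heq
    simp only [f, Sym2.eq_iff, Prod.mk.injEq] at heq
    have key : ∀ i i' : Fin 3, ¬(i = i' + 1 ∧ i + 1 = i') := by decide
    rcases heq with ⟨⟨rfl, rfl⟩, _, rfl, hs⟩ | ⟨⟨h1, _⟩, h2, _⟩
    · simp only [second] at hs
      rw [div_left_inj' (Units.ne_zero _), add_left_inj] at hs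
      rw [Subtype.ext (Units.ext hs)]
    · exact absurd ⟨h1, h2⟩ (key i i')
  have := Nat.card_le_card_of_injective f hf
  rw [Nat.card_coe_set_eq] at this
  refine le_trans (le_of_eq ?_) this
  simp only [Nat.card_prod, Nat.card_eq_fintype_card, Fintype.card_fin]
  ring

end Construction

theorem exists_subgroups_units {F : Type*} [Field F] [Finite F] {l : ℕ} (hl : Odd l)
    (hdvd : 2 * l ∣ Nat.card F - 1) :
    ∃ H K : Subgroup Fˣ, H ≤ K ∧ -1 ∈ K ∧ -1 ∉ H ∧ Nat.card H = l ∧ Nat.card K = 2 * l := by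
  have hcard : Nat.card Fˣ = Nat.card F - 1 := Nat.card_units F
  obtain ⟨g, hg⟩ := IsCyclic.exists_ofOrder_eq_natCard (α := Fˣ)
  obtain ⟨m, hm⟩ := hdvd
  have hpos : 0 < Nat.card Fˣ := Nat.card_pos
  have hm0 : m ≠ 0 := by
    rintro rfl
    omega
  have hk : orderOf (g ^ m) = 2 * l := by
    rw [orderOf_pow_of_dvd hm0 ⟨2 * l, by rw [hg, hcard, hm, mul_comm]⟩, hg, hcard, hm,
      Nat.mul_div_cancel _ (Nat.pos_of_ne_zero hm0)]
  set k := g ^ m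
  have hk2 : orderOf (k ^ 2) = l := by
    rw [orderOf_pow_of_dvd two_ne_zero ⟨l, hk⟩, hk, Nat.mul_div_cancel_left _ two_pos]
  have hl0 := hl.pos
  have hkl : k ^ l = -1 := by
    have h1 : k ^ l ≠ 1 := fun h => by
      have := Nat.le_of_dvd hl0 (hk ▸ orderOf_dvd_of_pow_eq_one h)
      omega
    have h2 : ((k ^ l : Fˣ) : F) ^ 2 = 1 := by
      rw [← Units.val_pow_eq_pow_val, ← pow_mul, mul_comm, ← hk, pow_orderOf_eq_one, Units.val_one]
    rcases mul_self_eq_one_iff.1 ((sq _).symm.trans h2) with h | h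
    · exact absurd (Units.ext h) h1
    · exact Units.ext (by simpa using h)
  refine ⟨Subgroup.zpowers (k ^ 2), Subgroup.zpowers k, ?_, hkl ▸ Subgroup.npow_mem_zpowers k l, ?_,
    by rw [Nat.card_zpowers, hk2], by rw [Nat.card_zpowers, hk]⟩
  · rw [Subgroup.zpowers_le]
    exact Subgroup.npow_mem_zpowers k 2
  · intro h
    have hdvd : orderOf (-1 : Fˣ) ∣ l := by
      rw [← hk2]
      exact orderOf_dvd_of_mem_zpowers h
    have h1 : (-1 : Fˣ) ^ l = 1 := orderOf_dvd_iff_pow_eq_one.1 hdvd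
    rw [hl.neg_one_pow, ← hkl] at h1
    have := Nat.le_of_dvd hl0 (hk ▸ orderOf_dvd_of_pow_eq_one h1)
    omega

theorem le_exTri_of_isPrimePow {t n q : ℕ} (ht : Odd (t - 1)) (hq : IsPrimePow q)
    (hmod : q ≡ 1 [MOD 2 * (t - 1)]) (hn : q * (q - 1) ≤ 2 * (t - 1) * n) :
    3 * q * (q - 1) ^ 2 ≤ 4 * (t - 1) * exTri t n := by
  obtain ⟨p, k, hp, hk, rfl⟩ := hq
  have : Fact p.Prime := ⟨hp.nat_prime⟩
  have hF : Nat.card (GaloisField p k) = p ^ k := GaloisField.card p k hk.ne'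
  have hdvd : 2 * (t - 1) ∣ Nat.card (GaloisField p k) - 1 := by
    rw [hF]
    exact (Nat.modEq_iff_dvd' (Nat.one_le_pow _ _ hp.nat_prime.pos)).1 hmod.symm
  obtain ⟨H, K, hHK, hneg, hnegH, hH, hK⟩ := exists_subgroups_units ht hdvd
  have hindex : Nat.card ((GaloisField p k)ˣ ⧸ K) * (2 * (t - 1)) = p ^ k - 1 := by
    rw [← hK, ← K.card_eq_card_quotient_mul_card_subgroup, Nat.card_units, hF]
  set c := Nat.card ((GaloisField p k)ˣ ⧸ K)
  have hpos := ht.pos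
  have hX : Nat.card (((GaloisField p k)ˣ ⧸ K) × GaloisField p k) ≤ n := by
    rw [Nat.card_prod, hF]
    rw [← hindex] at hn
    refine Nat.le_of_mul_le_mul_left (le_trans (le_of_eq ?_) hn) (by positivity : 0 < 2 * (t - 1))
    ring
  have hle := (le_ncard_edgeSet_cyclicSympGraph (H := H) (K := K)).trans
    (card_edgeSet_le_exTri (t := t) hX (cyclicSympGraph H K)
      (fun _ _ => cyclicSympGraph_adj_fst_ne H K)
      (hH ▸ ncard_commonNeighbors_cyclicSympGraph_le hHK hneg hnegH))
  rw [hH, hF] at hle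
  calc 3 * p ^ k * (p ^ k - 1) ^ 2
      = 4 * (t - 1) * (3 * (c * p ^ k) * c * (t - 1)) := by
        rw [← hindex]
        ring
    _ ≤ _ := Nat.mul_le_mul_left _ hle

theorem eventually_exists_isPrimePow_modEq_one_Icc (m : ℕ) [NeZero m] {r : ℝ} (hr0 : 0 < r)
    (hr1 : r < 1) :
    ∀ᶠ y : ℝ in Filter.atTop, ∃ q : ℕ, IsPrimePow q ∧ q ≡ 1 [MOD m] ∧ r * y + 1 ≤ q ∧ q ≤ y := by
  obtain ⟨r', hrr', hr'1⟩ := exists_between hr1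
  have hr'0 := hr0.trans hrr'
  have hlog : Real.log r' < 0 := Real.log_neg hr'0 hr'1
  have hδ : 0 < -Real.log r' / 2 := by linarith
  have hlim : Filter.Tendsto (fun y => Real.log y - -Real.log r' / 2) Filter.atTop Filter.atTop :=
    Filter.tendsto_atTop_add_const_right _ _ Real.tendsto_log_atTop
  filter_upwards [hlim.eventually (eventually_exists_isPrimePow_modEq_one m hδ),
    Filter.eventually_gt_atTop 0, Filter.eventually_ge_atTop (1 / (r' - r))] with y hy hy0 hy1
  obtain ⟨q, hq, hmod, habs⟩ := hy
  have hq0 : (0 : ℝ) < q := by exact_mod_cast hq.pos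
  rw [abs_lt] at habs
  refine ⟨q, hq, hmod, ?_, ?_⟩
  · have h1 : r' * y ≤ q := by
      rw [← Real.log_le_log_iff (by positivity) hq0, Real.log_mul hr'0.ne' hy0.ne']
      linarith
    rw [div_le_iff₀ (by linarith)] at hy1
    linarith
  · rw [← Real.log_le_log_iff hq0 hy0]
    linarith

theorem natCast_rpow_three_halves (n : ℕ) : (n : ℝ) ^ (3 / 2 : ℝ) = √n ^ 3 := by
  rw [Real.sqrt_eq_rpow, ← Real.rpow_mul_natCast (by positivity)]
  norm_num

theorem exTri_div_le (t : ℕ) {n : ℕ} (hn : 0 < n) :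
    (exTri t n : ℝ) / (n : ℝ) ^ (3 / 2 : ℝ) ≤ 3 / √n + 3 / 2 * √(2 * (t - 1 : ℕ)) := by
  have hx : 0 < √(n : ℝ) := Real.sqrt_pos.2 (by exact_mod_cast hn)
  have hsq : √(n : ℝ) ^ 2 = n := Real.sq_sqrt (by positivity)
  have h := exTri_le t n
  have hcube : √((n : ℝ) ^ 3) = √n ^ 3 := by
    rw [Real.sqrt_eq_iff_mul_self_eq (by positivity) (by positivity)]
    calc (n : ℝ) ^ 3 = (√n ^ 2) ^ 3 := by rw [hsq]
      _ = √(n : ℝ) ^ 3 * √n ^ 3 := by ring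
  rw [Real.sqrt_mul (by positivity), hcube] at h
  rw [natCast_rpow_three_halves, div_le_iff₀ (by positivity)]
  refine h.trans_eq ?_
  field_simp
  linear_combination -2 * hsq

theorem eventually_lt_exTri_div {t : ℕ} (ht : Odd (t - 1)) {c : ℝ}
    (hc : c < 3 / 2 * √(2 * (t - 1 : ℕ))) :
    ∀ᶠ n : ℕ in Filter.atTop, c < (exTri t n : ℝ) / (n : ℝ) ^ (3 / 2 : ℝ) := by
  set l := t - 1 with hl
  have hl0 : 0 < l := ht.pos
  have hlR : (0 : ℝ) < l := by exact_mod_cast hl0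
  have : NeZero (2 * l) := ⟨by omega⟩
  set a := √(2 * (l : ℝ)) with ha
  have ha0 : 0 < a := Real.sqrt_pos.2 (by positivity)
  have hasq : a ^ 2 = 2 * l := Real.sq_sqrt (by positivity)
  have hcont : Filter.Tendsto (fun r : ℝ => r ^ 3 * (3 / 2 * a)) (nhdsWithin 1 (Set.Iio 1))
      (nhds (3 / 2 * a)) := by
    have : Continuous fun r : ℝ => r ^ 3 * (3 / 2 * a) := by fun_prop
    simpa using (this.tendsto 1).mono_left nhdsWithin_le_nhds
  obtain ⟨r, ⟨hrc, hr0⟩, hr1⟩ := (((hcont.eventually (lt_mem_nhds hc)).and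
    (nhdsWithin_le_nhds (lt_mem_nhds zero_lt_one))).and self_mem_nhdsWithin).exists
  have hlim : Filter.Tendsto (fun n : ℕ => a * √(n : ℝ)) Filter.atTop Filter.atTop :=
    (Real.tendsto_sqrt_atTop.comp tendsto_natCast_atTop_atTop).const_mul_atTop ha0
  filter_upwards [hlim.eventually (eventually_exists_isPrimePow_modEq_one_Icc (2 * l) hr0 hr1),
    Filter.eventually_gt_atTop 0] with n hn hn0
  obtain ⟨q, hq, hmod, hq1, hq2⟩ := hn
  have hx : 0 < √(n : ℝ) := Real.sqrt_pos.2 (by exact_mod_cast hn0)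
  have hsq : √(n : ℝ) ^ 2 = n := Real.sq_sqrt (by positivity)
  have hcast : ((q - 1 : ℕ) : ℝ) = q - 1 := by
    rw [Nat.cast_sub hq.one_lt.le, Nat.cast_one]
  have hqn : q * (q - 1) ≤ 2 * l * n := by
    have h : ((q * (q - 1 : ℕ) : ℕ) : ℝ) ≤ ((2 * l * n : ℕ) : ℝ) := by
      push_cast
      calc (q : ℝ) * (q - 1 : ℕ) ≤ (a * √n) * (a * √n) := by
            gcongr
            rw [hcast]
            linarith
        _ = 2 * l * n := by
            linear_combination √(n : ℝ) ^ 2 * hasq + 2 * l * hsq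
    exact_mod_cast h
  have hedge : (3 * q * (q - 1 : ℕ) ^ 2 : ℝ) ≤ 4 * l * exTri t n := by
    exact_mod_cast le_exTri_of_isPrimePow ht hq hmod hqn
  rw [hcast] at hedge
  refine hrc.trans_le ?_
  rw [natCast_rpow_three_halves, le_div_iff₀ (by positivity)]
  have hlow : 3 * (r * (a * √n)) * (r * (a * √n)) ^ 2 ≤ 3 * (q : ℝ) * (q - 1) ^ 2 := by
    gcongr <;> linarith
  have h4 : (0 : ℝ) < 4 * l := by positivity
  refine le_of_mul_le_mul_left (le_trans (le_of_eq ?_) (hlow.trans hedge)) h4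
  have : (4 * l : ℝ) = 2 * a ^ 2 := by rw [hasq]; ring
  rw [this]
  ring

/-- For even `t ≥ 2`,
`ex(n,n,n,K_{2,t}) = 3√((t-1)/2) · n^{3/2} + o(n^{3/2})`, i.e.
`lim_{n→∞} ex(n,n,n,K_{2,t}) / n^{3/2} = 3√(t-1)/√2`. -/
theorem stmt_11 (t : ℕ) (ht : 2 ≤ t) (hteven : Even t) :
    Filter.Tendsto (fun n : ℕ => (exTri t n : ℝ) / (n : ℝ) ^ (3 / 2 : ℝ))
      Filter.atTop (nhds (3 * Real.sqrt ((t : ℝ) - 1) / Real.sqrt 2)) := by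
  have hodd : Odd (t - 1) := Nat.Even.sub_odd (by omega) hteven odd_one
  have hconst : 3 * √((t : ℝ) - 1) / √2 = 3 / 2 * √(2 * (t - 1 : ℕ)) := by
    rw [Real.sqrt_mul zero_le_two, Nat.cast_sub (by omega), Nat.cast_one]
    have h2 : √(2 : ℝ) ^ 2 = 2 := Real.sq_sqrt zero_le_two
    field_simp
    rw [h2]
  rw [hconst]
  refine tendsto_order.2 ⟨fun c hc => eventually_lt_exTri_div hodd hc, fun c hc => ?_⟩
  have hlim : Filter.Tendsto (fun n : ℕ => 3 / √(n : ℝ) + 3 / 2 * √(2 * (t - 1 : ℕ)))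
      Filter.atTop (nhds (3 / 2 * √(2 * (t - 1 : ℕ)))) := by
    simpa using ((Real.tendsto_sqrt_atTop.comp tendsto_natCast_atTop_atTop).const_div_atTop
      (3 : ℝ)).add_const (3 / 2 * √(2 * (t - 1 : ℕ)))
  filter_upwards [hlim.eventually (gt_mem_nhds hc), Filter.eventually_gt_atTop 0] with n hn hn0
  exact (exTri_div_le t hn0).trans_lt hn
end
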